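/- arXiv:2203.15315 — 8 statements merged into one kernel-verified Lean document; each statement's English description precedes it below -/
import Mathlib

section
/- Let a = (a_n)_n and b = (b_n)_n be strictly decreasing sequences of positive reals converging to 0 such that b eventually separates a. Then the lower box-counting dimension of E_a is at most the lower box-counting dimension of E_b, and the upper box-counting dimension of E_a is at most the upper box-counting dimension of E_b. -/
open Filter Topology
open scoped ENNReal

/-- `coveringNumber r F` is the smallest number of sets of diameter at most `r`
needed to cover `F` (the box-counting function `N_r(F)`). -/
noncomputable def coveringNumber (r : ℝ) (F : Set ℝ) : ℕ :=
  sInf {n : ℕ | ∃ 𝒰 : Finset (Set ℝ), 𝒰.card = n ∧ (F ⊆ ⋃ U ∈ 𝒰, U) ∧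
    ∀ U ∈ 𝒰, EMetric.diam U ≤ ENNReal.ofReal r}

/-- The lower box-counting dimension `liminf_{r → 0⁺} log N_r(F) / (-log r)`. -/
noncomputable def lowerBoxDim (F : Set ℝ) : ℝ :=
  liminf (fun r : ℝ => Real.log (coveringNumber r F) / (-Real.log r)) (𝓝[>] 0)

/-- The upper box-counting dimension `limsup_{r → 0⁺} log N_r(F) / (-log r)`. -/
noncomputable def upperBoxDim (F : Set ℝ) : ℝ :=
  limsup (fun r : ℝ => Real.log (coveringNumber r F) / (-Real.log r)) (𝓝[>] 0)

/-- Any finite cover by sets of diameter at most `r` bounds the covering number. -/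
theorem coveringNumber_le_card {r : ℝ} {F : Set ℝ} (𝒰 : Finset (Set ℝ))
    (hcover : F ⊆ ⋃ U ∈ 𝒰, U) (hdiam : ∀ U ∈ 𝒰, Metric.ediam U ≤ ENNReal.ofReal r) :
    coveringNumber r F ≤ 𝒰.card :=
  Nat.sInf_le ⟨𝒰, rfl, hcover, hdiam⟩

/-- The interval `[0, M]` is covered by `⌊M / r⌋₊ + 1` intervals of length `r`. -/
theorem exists_cover_of_subset_Icc {r M : ℝ} {F : Set ℝ} (hr : 0 < r) (hF : F ⊆ Set.Icc 0 M) :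
    ∃ 𝒰 : Finset (Set ℝ), 𝒰.card ≤ ⌊M / r⌋₊ + 1 ∧ (F ⊆ ⋃ U ∈ 𝒰, U) ∧
      ∀ U ∈ 𝒰, Metric.ediam U ≤ ENNReal.ofReal r := by
  classical
  refine ⟨(Finset.range (⌊M / r⌋₊ + 1)).image
    fun k : ℕ => Set.Icc ((k : ℝ) * r) ((k + 1) * r), ?_, ?_, ?_⟩
  · exact Finset.card_image_le.trans (Finset.card_range _).le
  · intro x hx
    obtain ⟨hx0, hxM⟩ := hF hx
    simp only [Finset.mem_image, Set.mem_iUnion, exists_prop]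
    refine ⟨_, ⟨⌊x / r⌋₊, ?_, rfl⟩, ?_, ?_⟩
    · exact Finset.mem_range.2 (Nat.lt_succ_of_le (Nat.floor_mono (by gcongr)))
    · exact (le_div_iff₀ hr).1 (Nat.floor_le (by positivity))
    · exact ((div_lt_iff₀ hr).1 (Nat.lt_floor_add_one (x / r))).le
  · simp only [Finset.mem_image]
    rintro _ ⟨k, -, rfl⟩
    rw [Real.ediam_Icc]
    exact ENNReal.ofReal_le_ofReal (by linarith)

/-- For a subset of `[0, M]` the covering number is attained. -/
theorem exists_cover_card_eq_coveringNumber {r M : ℝ} {F : Set ℝ} (hr : 0 < r)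
    (hF : F ⊆ Set.Icc 0 M) :
    ∃ 𝒰 : Finset (Set ℝ), 𝒰.card = coveringNumber r F ∧ (F ⊆ ⋃ U ∈ 𝒰, U) ∧
      ∀ U ∈ 𝒰, Metric.ediam U ≤ ENNReal.ofReal r := by
  obtain ⟨𝒰, -, hcover, hdiam⟩ := exists_cover_of_subset_Icc hr hF
  have hne : {n : ℕ | ∃ 𝒰 : Finset (Set ℝ), 𝒰.card = n ∧ (F ⊆ ⋃ U ∈ 𝒰, U) ∧
      ∀ U ∈ 𝒰, Metric.ediam U ≤ ENNReal.ofReal r}.Nonempty :=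
    ⟨𝒰.card, 𝒰, rfl, hcover, hdiam⟩
  exact Nat.sInf_mem hne

theorem coveringNumber_le_of_subset_Icc {r M : ℝ} {F : Set ℝ} (hr : 0 < r)
    (hF : F ⊆ Set.Icc 0 M) : coveringNumber r F ≤ ⌊M / r⌋₊ + 1 := by
  obtain ⟨𝒰, hcard, hcover, hdiam⟩ := exists_cover_of_subset_Icc hr hF
  exact (coveringNumber_le_card 𝒰 hcover hdiam).trans hcard

theorem coveringNumber_pos {r M : ℝ} {F : Set ℝ} (hr : 0 < r) (hF : F ⊆ Set.Icc 0 M)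
    (hne : F.Nonempty) : 0 < coveringNumber r F := by
  obtain ⟨𝒰, hcard, hcover, -⟩ := exists_cover_card_eq_coveringNumber hr hF
  obtain ⟨x, hx⟩ := hne
  obtain ⟨U, hU, -⟩ := Set.mem_iUnion₂.1 (hcover hx)
  exact hcard ▸ Finset.card_pos.2 ⟨U, hU⟩

/-- If `b` separates `a` from index `n₀` on, then covers of `E_b` by `N` sets yield covers of
`E_a` by `2 N + n₀` sets of no larger diameter. -/
theorem coveringNumber_le_of_separates {a b : ℕ → ℝ} {n₀ : ℕ} {r M : ℝ} (hr : 0 < r)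
    (ha : Antitone a) (hb : Set.range b ∪ {0} ⊆ Set.Icc 0 M)
    (hsep : ∀ n ≥ n₀, ∃ m : ℕ, a (n + 1) ≤ b m ∧ b m ≤ a n) :
    coveringNumber r (Set.range a ∪ {0}) ≤ 2 * coveringNumber r (Set.range b ∪ {0}) + n₀ := by
  classical
  obtain ⟨𝒰, hcard, hcover, hdiam⟩ := exists_cover_card_eq_coveringNumber hr hb
  choose! m hm using hsep
  let first : Set ℝ → ℕ := fun U => sInf {n | n₀ ≤ n ∧ b (m n) ∈ U}
  let 𝒱 : Finset (Set ℝ) := (𝒰.image (convexHull ℝ) ∪ 𝒰.image fun U => {a (first U)}) ∪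
    (Finset.range n₀).image fun n => {a n}
  have hcard𝒱 : 𝒱.card ≤ 2 * 𝒰.card + n₀ := by
    have h₁ : (𝒰.image (convexHull ℝ)).card ≤ 𝒰.card := Finset.card_image_le
    have h₂ : (𝒰.image fun U => ({a (first U)} : Set ℝ)).card ≤ 𝒰.card := Finset.card_image_le
    have h₃ : ((Finset.range n₀).image fun n => ({a n} : Set ℝ)).card ≤ n₀ :=
      Finset.card_image_le.trans (Finset.card_range _).le
    have h₄ := Finset.card_union_le (𝒰.image (convexHull ℝ)) (𝒰.image fun U => {a (first U)})
    have h₅ : 𝒱.card ≤ _ := Finset.card_union_le _ _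
    omega
  rw [← hcard]
  refine (coveringNumber_le_card 𝒱 ?_ ?_).trans hcard𝒱
  · rintro x (⟨n, rfl⟩ | hx)
    · rw [Set.mem_iUnion₂]
      by_cases hn : n < n₀
      · exact ⟨{a n}, Finset.mem_union_right _
          (Finset.mem_image_of_mem _ (Finset.mem_range.2 hn)), rfl⟩
      push Not at hn
      obtain ⟨U, hU, hbU⟩ := Set.mem_iUnion₂.1 (hcover (Or.inl ⟨m n, rfl⟩))
      have hmem : n ∈ {n | n₀ ≤ n ∧ b (m n) ∈ U} := ⟨hn, hbU⟩
      obtain ⟨hk, hbk⟩ : n₀ ≤ first U ∧ b (m (first U)) ∈ U := Nat.sInf_mem ⟨n, hmem⟩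
      have hle : first U ≤ n := Nat.sInf_le hmem
      rcases hle.eq_or_lt with heq | hlt
      · exact ⟨{a (first U)}, Finset.mem_union_left _
          (Finset.mem_union_right _ (Finset.mem_image_of_mem _ hU)), by rw [heq]; rfl⟩
      · refine ⟨convexHull ℝ U, Finset.mem_union_left _
          (Finset.mem_union_left _ (Finset.mem_image_of_mem _ hU)), ?_⟩
        exact (convex_convexHull ℝ U).ordConnected.out (subset_convexHull ℝ U hbU)
          (subset_convexHull ℝ U hbk) ⟨(hm n hn).2, (ha hlt).trans (hm _ hk).1⟩
    · obtain ⟨U, hU, hxU⟩ := Set.mem_iUnion₂.1 (hcover (Or.inr hx))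
      exact Set.mem_iUnion₂.2 ⟨convexHull ℝ U, Finset.mem_union_left _
        (Finset.mem_union_left _ (Finset.mem_image_of_mem _ hU)), subset_convexHull ℝ U hxU⟩
  · intro V hV
    simp only [𝒱, Finset.mem_union, Finset.mem_image] at hV
    rcases hV with (⟨U, hU, rfl⟩ | ⟨U, -, rfl⟩) | ⟨n, -, rfl⟩
    · rw [convexHull_ediam]
      exact hdiam U hU
    · simp
    · simp

theorem tendsto_const_div_neg_log (c : ℝ) :
    Tendsto (fun r : ℝ => c / (-Real.log r)) (𝓝[>] 0) (𝓝 0) :=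
  (tendsto_neg_atBot_atTop.comp Real.tendsto_log_nhdsGT_zero).const_div_atTop c

theorem eventually_zero_le_log_coveringNumber_div (F : Set ℝ) :
    ∀ᶠ r : ℝ in 𝓝[>] 0, 0 ≤ Real.log (coveringNumber r F) / (-Real.log r) := by
  filter_upwards [Ioo_mem_nhdsGT one_pos] with r hr
  exact div_nonneg (Real.log_natCast_nonneg _) (neg_nonneg.2 (Real.log_nonpos hr.1.le hr.2.le))

theorem eventually_log_coveringNumber_div_le {F : Set ℝ} {M : ℝ} (hF : F ⊆ Set.Icc 0 M)
    (hne : F.Nonempty) :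
    ∀ᶠ r : ℝ in 𝓝[>] 0, Real.log (coveringNumber r F) / (-Real.log r) ≤ 2 := by
  have hM : 0 ≤ M := let ⟨x, hx⟩ := hne; (hF hx).1.trans (hF hx).2
  filter_upwards [Ioo_mem_nhdsGT one_pos,
    (tendsto_const_div_neg_log (Real.log (M + 1))).eventually (ge_mem_nhds one_pos)] with r hr hlog
  obtain ⟨hr0, hr1⟩ := hr
  have hneg : 0 < -Real.log r := neg_pos.2 (Real.log_neg hr0 hr1)
  rw [div_le_iff₀ hneg] at hlog ⊢
  have hN : (coveringNumber r F : ℝ) ≤ (M + 1) / r := by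
    calc (coveringNumber r F : ℝ) ≤ (⌊M / r⌋₊ : ℝ) + 1 := by
          exact_mod_cast coveringNumber_le_of_subset_Icc hr0 hF
      _ ≤ M / r + 1 / r := by
          gcongr
          · exact Nat.floor_le (by positivity)
          · exact (one_le_div hr0).2 hr1.le
      _ = (M + 1) / r := by ring
  have hpos : (0 : ℝ) < coveringNumber r F := by exact_mod_cast coveringNumber_pos hr0 hF hne
  have := Real.log_le_log hpos hN
  rw [Real.log_div (by positivity) hr0.ne'] at this
  linarith

/-- A multiplicative bound between covering numbers gives an asymptotic bound between the
quotients defining the box dimensions. -/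
theorem eventually_log_coveringNumber_div_le_add {F G : Set ℝ} {C ε : ℝ} (hε : 0 < ε)
    (hC : 0 < C) (hF : ∀ r : ℝ, 0 < r → 0 < coveringNumber r F)
    (hFG : ∀ r : ℝ, 0 < r → (coveringNumber r F : ℝ) ≤ C * coveringNumber r G) :
    ∀ᶠ r : ℝ in 𝓝[>] 0, Real.log (coveringNumber r F) / (-Real.log r) ≤
      Real.log (coveringNumber r G) / (-Real.log r) + ε := by
  filter_upwards [Ioo_mem_nhdsGT one_pos,
    (tendsto_const_div_neg_log (Real.log C)).eventually (ge_mem_nhds hε)] with r hr hlog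
  have hneg : 0 < -Real.log r := neg_pos.2 (Real.log_neg hr.1 hr.2)
  have hFpos : (0 : ℝ) < coveringNumber r F := by exact_mod_cast hF r hr.1
  have hGpos : (0 : ℝ) < coveringNumber r G :=
    pos_of_mul_pos_right (hFpos.trans_le (hFG r hr.1)) hC.le
  have hle := Real.log_le_log hFpos (hFG r hr.1)
  rw [Real.log_mul hC.ne' hGpos.ne'] at hle
  calc Real.log (coveringNumber r F) / (-Real.log r)
      ≤ (Real.log C + Real.log (coveringNumber r G)) / (-Real.log r) := by gcongr
    _ ≤ Real.log (coveringNumber r G) / (-Real.log r) + ε := by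
      rw [add_div]
      linarith

/-- **Lemma 1.8.** If `a`, `b` are strictly decreasing sequences of positive reals
converging to `0` and `b` eventually separates `a`, then the lower and upper
box-counting dimensions of `E_a = {a_n} ∪ {0}` are bounded by those of
`E_b = {b_n} ∪ {0}`. -/
theorem boxDim_le_of_eventually_separates
    (a b : ℕ → ℝ) (hapos : ∀ n, 0 < a n) (hbpos : ∀ n, 0 < b n)
    (haanti : StrictAnti a) (hbanti : StrictAnti b)
    (halim : Tendsto a atTop (𝓝 0)) (hblim : Tendsto b atTop (𝓝 0))
    (hsep : ∃ n₀ : ℕ, ∀ n ≥ n₀, ∃ m : ℕ, a (n + 1) ≤ b m ∧ b m ≤ a n) :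
    lowerBoxDim (Set.range a ∪ {0}) ≤ lowerBoxDim (Set.range b ∪ {0}) ∧
      upperBoxDim (Set.range a ∪ {0}) ≤ upperBoxDim (Set.range b ∪ {0}) := by
  obtain ⟨n₀, hsep⟩ := hsep
  have hsub : ∀ c : ℕ → ℝ, (∀ n, 0 < c n) → StrictAnti c →
      Set.range c ∪ {0} ⊆ Set.Icc 0 (c 0) := by
    rintro c hpos hanti x (⟨n, rfl⟩ | rfl)
    · exact ⟨(hpos n).le, hanti.antitone n.zero_le⟩
    · exact ⟨le_rfl, (hpos 0).le⟩
  have hne : ∀ c : ℕ → ℝ, (Set.range c ∪ {0}).Nonempty := fun c => ⟨0, Or.inr rfl⟩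
  have hA := hsub a hapos haanti
  have hB := hsub b hbpos hbanti
  have hC : ∀ r : ℝ, 0 < r → (coveringNumber r (Set.range a ∪ {0}) : ℝ) ≤
      (n₀ + 2 : ℝ) * coveringNumber r (Set.range b ∪ {0}) := by
    intro r hr
    have h := coveringNumber_le_of_separates hr haanti.antitone hB hsep
    have hpos := coveringNumber_pos hr hB (hne b)
    have h' : coveringNumber r (Set.range a ∪ {0}) ≤
        (n₀ + 2) * coveringNumber r (Set.range b ∪ {0}) := by nlinarith
    exact_mod_cast h'
  have hle : ∀ ε : ℝ, 0 < ε → _ := fun ε hε =>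
    eventually_log_coveringNumber_div_le_add hε (by positivity)
      (fun r hr => coveringNumber_pos hr hA (hne a)) hC
  have hlow := fun c : ℕ → ℝ =>
    isBoundedUnder_of_eventually_ge (eventually_zero_le_log_coveringNumber_div (Set.range c ∪ {0}))
  have hupa := isBoundedUnder_of_eventually_le (eventually_log_coveringNumber_div_le hA (hne a))
  have hupb := isBoundedUnder_of_eventually_le (eventually_log_coveringNumber_div_le hB (hne b))
  constructor
  · refine le_of_forall_pos_le_add fun ε hε => ?_
    unfold lowerBoxDim
    rw [← liminf_add_const _ _ _ hupb.isCoboundedUnder_ge (hlow b)]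
    refine liminf_le_liminf (hle ε hε) (hlow a) (IsBoundedUnder.isCoboundedUnder_ge ?_)
    exact isBoundedUnder_of_eventually_le ((eventually_log_coveringNumber_div_le hB (hne b)).mono
      fun r hr => add_le_add_left hr ε)
  · refine le_of_forall_pos_le_add fun ε hε => ?_
    unfold upperBoxDim
    rw [← limsup_add_const _ _ _ hupb (hlow b).isCoboundedUnder_le]
    refine limsup_le_limsup (hle ε hε) (hlow a).isCoboundedUnder_le ?_
    exact isBoundedUnder_of_eventually_le ((eventually_log_coveringNumber_div_le hB (hne b)).mono
      fun r hr => add_le_add_left hr ε)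
end

section
/- Let 0 < q < p, let a = (a_n)_n ∈ S_p and b = (b_m)_m ∈ S_q, and suppose both a and b are decreasing sequences with decreasing gaps. Then b eventually separates a. -/
open Filter Topology

theorem eventually_le_rpow_neg_of_tendsto {a : ℕ → ℝ} (hapos : ∀ n, 0 < a n) {p r : ℝ}
    (h : Tendsto (fun n : ℕ => (-Real.log (a n)) / Real.log n) atTop (𝓝 p)) (hr : r < p) :
    ∀ᶠ n : ℕ in atTop, a n ≤ (n : ℝ) ^ (-r) := by
  filter_upwards [h.eventually_const_lt hr, eventually_ge_atTop 2] with n hn h2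
  have hn1 : (1 : ℝ) < n := by exact_mod_cast h2
  have hlog := Real.log_pos hn1
  rw [lt_div_iff₀ hlog] at hn
  rw [← Real.log_le_log_iff (hapos n) (Real.rpow_pos_of_pos (by linarith) _),
    Real.log_rpow (by linarith)]
  linarith

theorem eventually_rpow_neg_le_of_tendsto {a : ℕ → ℝ} (hapos : ∀ n, 0 < a n) {p r : ℝ}
    (h : Tendsto (fun n : ℕ => (-Real.log (a n)) / Real.log n) atTop (𝓝 p)) (hr : p < r) :
    ∀ᶠ n : ℕ in atTop, (n : ℝ) ^ (-r) ≤ a n := by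
  filter_upwards [h.eventually_lt_const hr, eventually_ge_atTop 2] with n hn h2
  have hn1 : (1 : ℝ) < n := by exact_mod_cast h2
  have hlog := Real.log_pos hn1
  rw [div_lt_iff₀ hlog] at hn
  rw [← Real.log_le_log_iff (Real.rpow_pos_of_pos (by linarith) _) (hapos n),
    Real.log_rpow (by linarith)]
  linarith

theorem eventually_const_mul_rpow_neg_le (K : ℝ) {x y : ℝ} (h : y < x) :
    ∀ᶠ n : ℕ in atTop, K * (n : ℝ) ^ (-x) ≤ (n : ℝ) ^ (-y) := by
  have ht := (tendsto_rpow_atTop (sub_pos.2 h)).comp (tendsto_natCast_atTop_atTop (R := ℝ))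
  filter_upwards [ht.eventually_ge_atTop K, eventually_ge_atTop 1] with n hn h1
  have hn0 : (0 : ℝ) < n := by exact_mod_cast h1
  calc K * (n : ℝ) ^ (-x) ≤ (n : ℝ) ^ (x - y) * (n : ℝ) ^ (-x) :=
        mul_le_mul_of_nonneg_right hn (by positivity)
    _ = (n : ℝ) ^ (-y) := by rw [← Real.rpow_add hn0]; ring_nf

theorem antitone_gap {a : ℕ → ℝ} (h : ∀ n, a (n + 1) - a (n + 2) ≤ a n - a (n + 1)) :
    Antitone fun n => a n - a (n + 1) :=
  antitone_nat_of_succ_le h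

theorem sub_add_le_mul_gap {a : ℕ → ℝ} (h : Antitone fun n => a n - a (n + 1)) (n k : ℕ) :
    a n - a (n + k) ≤ k * (a n - a (n + 1)) := by
  induction k with
  | zero => simp
  | succ k ih =>
    have := h (Nat.le_add_right n k)
    simp only [← add_assoc] at this ⊢
    push_cast
    linarith

theorem mul_gap_le_sub_add {a : ℕ → ℝ} (h : Antitone fun n => a n - a (n + 1)) (n k : ℕ) :
    k * (a (n + k) - a (n + k + 1)) ≤ a n - a (n + k) := by
  induction k with
  | zero => simp
  | succ k ih =>
    have h1 := h (Nat.le_succ (n + k))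
    have h2 := mul_le_mul_of_nonneg_left h1 (Nat.cast_nonneg (α := ℝ) k)
    simp only [← add_assoc, Nat.succ_eq_add_one] at h1 h2 ⊢
    push_cast
    linarith

theorem eventually_rpow_neg_le_gap {a : ℕ → ℝ} (hapos : ∀ n, 0 < a n) {p c : ℝ} (hp : 0 < p)
    (haSp : Tendsto (fun n : ℕ => (-Real.log (a n)) / Real.log n) atTop (𝓝 p))
    (hgap : Antitone fun n => a n - a (n + 1)) (hc : p + 1 < c) :
    ∀ᶠ n : ℕ in atTop, (n : ℝ) ^ (-c) ≤ a n - a (n + 1) := by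
  obtain ⟨t, ht1, htc⟩ := exists_between (show 1 < c - p by linarith)
  have ht0 : 0 < t := by linarith
  obtain ⟨r, hpr, hr⟩ := exists_between
    (show p < min (p * t) (c - t) from lt_min (by nlinarith) (by linarith))
  obtain ⟨hrpt, hrc⟩ := lt_min_iff.1 hr
  obtain ⟨r', hr', hr'p⟩ := exists_between ((div_lt_iff₀ ht0).2 hrpt)
  have hr'0 : 0 < r' := lt_trans (div_pos (hp.trans hpr) ht0) hr'
  rw [div_lt_iff₀ ht0] at hr'
  have hM : Tendsto (fun n : ℕ => ⌈(n : ℝ) ^ t⌉₊) atTop atTop :=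
    tendsto_nat_ceil_atTop.comp ((tendsto_rpow_atTop ht0).comp tendsto_natCast_atTop_atTop)
  filter_upwards [hM.eventually (eventually_le_rpow_neg_of_tendsto hapos haSp hr'p),
    eventually_rpow_neg_le_of_tendsto hapos haSp hpr,
    eventually_const_mul_rpow_neg_le 2 hr',
    eventually_const_mul_rpow_neg_le 2 (show r < c - t from hrc),
    eventually_ge_atTop 1] with n hMn hn h1 h2 hn1
  have hn1' : (1 : ℝ) ≤ n := by exact_mod_cast hn1
  have hn0 : (0 : ℝ) < n := by linarith
  have hpow : 0 < (n : ℝ) ^ t := Real.rpow_pos_of_pos hn0 t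
  have hle : (n : ℝ) ≤ (n : ℝ) ^ t := Real.self_le_rpow_of_one_le hn1' ht1.le
  obtain ⟨k, hk⟩ := Nat.exists_eq_add_of_le
    (show n ≤ ⌈(n : ℝ) ^ t⌉₊ by exact_mod_cast hle.trans (Nat.le_ceil _))
  have hkle : (k : ℝ) ≤ (n : ℝ) ^ t := by
    have h3 := Nat.ceil_lt_add_one hpow.le
    rw [hk] at h3
    push_cast at h3
    linarith
  have hMle : a (n + k) ≤ (n : ℝ) ^ (-(r' * t)) := by
    rw [← hk]
    refine hMn.trans ((Real.rpow_le_rpow_of_nonpos hpow (Nat.le_ceil _) (by linarith)).trans_eq ?_)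
    rw [← Real.rpow_mul hn0.le]
    ring_nf
  have hsum := sub_add_le_mul_gap hgap n k
  have hkey : (n : ℝ) ^ (-(c - t)) ≤ k * (a n - a (n + 1)) := by linarith
  have hgap0 : 0 ≤ a n - a (n + 1) := by
    have h4 : 0 < (n : ℝ) ^ (-(c - t)) := Real.rpow_pos_of_pos hn0 _
    exact (pos_of_mul_pos_right (h4.trans_le hkey) k.cast_nonneg).le
  refine le_of_mul_le_mul_left ?_ hpow
  calc (n : ℝ) ^ t * (n : ℝ) ^ (-c) = (n : ℝ) ^ (-(c - t)) := by
        rw [← Real.rpow_add hn0]; ring_nf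
    _ ≤ k * (a n - a (n + 1)) := hkey
    _ ≤ (n : ℝ) ^ t * (a n - a (n + 1)) := mul_le_mul_of_nonneg_right hkle hgap0

theorem eventually_gap_le_rpow_neg {b : ℕ → ℝ} (hbpos : ∀ n, 0 < b n) {q c : ℝ} (hq : 0 < q)
    (hbSq : Tendsto (fun n : ℕ => (-Real.log (b n)) / Real.log n) atTop (𝓝 q))
    (hgap : Antitone fun n => b n - b (n + 1)) (hc : c < q + 1) :
    ∀ᶠ n : ℕ in atTop, b n - b (n + 1) ≤ ((n + 1 : ℕ) : ℝ) ^ (-c) := by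
  obtain ⟨r, hr, hrq⟩ := exists_between (show max (c - 1) 0 < q from max_lt (by linarith) hq)
  obtain ⟨hrc, hr0⟩ := max_lt_iff.1 hr
  have hhalf : Tendsto (fun n : ℕ => n / 2) atTop atTop :=
    Nat.tendsto_div_const_atTop (by norm_num)
  filter_upwards [hhalf.eventually (eventually_le_rpow_neg_of_tendsto hbpos hbSq hrq),
    (tendsto_add_atTop_nat 1).eventually
      (eventually_const_mul_rpow_neg_le (4 ^ (r + 1)) (show c < r + 1 by linarith)),
    eventually_ge_atTop 2] with n hn h1 h2
  set m := n / 2 with hm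
  have hm0 : (0 : ℝ) < m := by exact_mod_cast (show 0 < m by omega)
  have hm4 : ((n + 1 : ℕ) : ℝ) / 4 ≤ m := by
    rw [div_le_iff₀ (by norm_num)]
    exact_mod_cast (show n + 1 ≤ m * 4 by omega)
  have hsum := mul_gap_le_sub_add hgap m m
  have hanti : b n - b (n + 1) ≤ b (m + m) - b (m + m + 1) := hgap (show m + m ≤ n by omega)
  have hpos := hbpos (m + m)
  refine le_trans (le_of_mul_le_mul_left ?_ hm0) h1
  calc (m : ℝ) * (b n - b (n + 1)) ≤ m * (b (m + m) - b (m + m + 1)) :=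
        mul_le_mul_of_nonneg_left hanti hm0.le
    _ ≤ (m : ℝ) ^ (-r) := by linarith
    _ = m * (m : ℝ) ^ (-(r + 1)) := by
        rw [← Real.rpow_one_add' hm0.le (by linarith)]; ring_nf
    _ ≤ m * (((n + 1 : ℕ) : ℝ) / 4) ^ (-(r + 1)) :=
        mul_le_mul_of_nonneg_left
          (Real.rpow_le_rpow_of_nonpos (by positivity) hm4 (by linarith)) hm0.le
    _ = m * (4 ^ (r + 1) * ((n + 1 : ℕ) : ℝ) ^ (-(r + 1))) := by
        rw [Real.div_rpow (by positivity) (by norm_num), Real.rpow_neg (by norm_num : (0:ℝ) ≤ 4),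
          div_inv_eq_mul, mul_comm (4 ^ (r + 1))]

/-- **Lemma 1.9.** If `a ∈ S_p` and `b ∈ S_q` are decreasing sequences with
decreasing gaps and `0 < q < p`, then `b` eventually separates `a`: there is `n₀`
such that for every `n ≥ n₀` some `b m` lies in `[a (n+1), a n]`. -/
theorem eventually_separates_of_decreasing_gaps
    (p q : ℝ) (hq : 0 < q) (hqp : q < p)
    (a b : ℕ → ℝ) (hapos : ∀ n, 0 < a n) (hbpos : ∀ n, 0 < b n)
    (halim : Tendsto a atTop (𝓝 0)) (hblim : Tendsto b atTop (𝓝 0))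
    (haSp : Tendsto (fun n : ℕ => (-Real.log (a n)) / Real.log n) atTop (𝓝 p))
    (hbSq : Tendsto (fun n : ℕ => (-Real.log (b n)) / Real.log n) atTop (𝓝 q))
    (hadec : Antitone a) (hbdec : Antitone b)
    (hagaps : ∀ n, a (n + 1) - a (n + 2) ≤ a n - a (n + 1))
    (hbgaps : ∀ n, b (n + 1) - b (n + 2) ≤ b n - b (n + 1)) :
    ∃ n₀ : ℕ, ∀ n ≥ n₀, ∃ m : ℕ, a (n + 1) ≤ b m ∧ b m ≤ a n := by
  have hp : 0 < p := hq.trans hqp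
  obtain ⟨C, hpC, hC⟩ := exists_between
    (show p + 1 < p * (q + 1) / q by rw [lt_div_iff₀ hq]; linarith)
  have hC0 : 0 < C := by linarith
  obtain ⟨c, hCc, hcq⟩ := exists_between
    (show C * q / p < q + 1 by rw [div_lt_iff₀ hp]; rw [lt_div_iff₀ hq] at hC; linarith)
  have hc0 : 0 < c := lt_trans (by positivity) hCc
  obtain ⟨r, hCr, hrp⟩ := exists_between
    (show C * q / c < p by rw [div_lt_iff₀ hc0]; rw [div_lt_iff₀ hp] at hCc; linarith)
  have hr0 : 0 < r := lt_trans (by positivity) hCr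
  obtain ⟨s, hqs, hs⟩ := exists_between
    (show q < r * c / C by rw [lt_div_iff₀ hC0]; rw [div_lt_iff₀ hc0] at hCr; linarith)
  have hs0 : 0 < s := hq.trans hqs
  rw [lt_div_iff₀ hC0] at hs
  obtain ⟨K, hK⟩ := eventually_atTop.1
    ((eventually_gap_le_rpow_neg hbpos hq hbSq (antitone_gap hbgaps) hcq).and
      ((tendsto_add_atTop_nat 1).eventually (eventually_rpow_neg_le_of_tendsto hbpos hbSq hqs)))
  refine eventually_atTop.1 ?_
  filter_upwards [eventually_rpow_neg_le_gap hapos hp haSp (antitone_gap hagaps) hpC,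
    eventually_le_rpow_neg_of_tendsto hapos haSp hrp,
    halim.eventually_lt_const (hbpos K), eventually_ge_atTop 1] with n hgap han hanK hn1
  have hn1' : (1 : ℝ) ≤ n := by exact_mod_cast hn1
  have hn0 : (0 : ℝ) < n := by linarith
  have hex : ∃ m, b m ≤ a n := (hblim.eventually_le_const (hapos n)).exists
  classical
  have hfind := Nat.find_spec hex
  have hmin := fun m => Nat.find_min hex (m := m)
  refine ⟨Nat.find hex, ?_, hfind⟩
  generalize Nat.find hex = m at hfind hmin
  have hKm : K < m := by
    by_contra! hmK
    linarith [hbdec hmK]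
  obtain ⟨k, rfl⟩ : ∃ k, m = k + 1 := ⟨m - 1, by omega⟩
  obtain ⟨hbgap, hblow⟩ := hK k (by omega)
  have hbk : a n < b k := not_le.1 (hmin k (by omega))
  have hk0 : (0 : ℝ) < ((k + 1 : ℕ) : ℝ) := by positivity
  have hks : ((k + 1 : ℕ) : ℝ) ^ (-s) ≤ (n : ℝ) ^ (-r) := hblow.trans (hfind.trans han)
  have hsmall : ((k + 1 : ℕ) : ℝ) ^ (-c) ≤ (n : ℝ) ^ (-C) := by
    calc ((k + 1 : ℕ) : ℝ) ^ (-c) = (((k + 1 : ℕ) : ℝ) ^ (-s)) ^ (c / s) := by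
          rw [← Real.rpow_mul hk0.le]
          congr 1
          field_simp
      _ ≤ ((n : ℝ) ^ (-r)) ^ (c / s) :=
          Real.rpow_le_rpow (by positivity) hks (by positivity)
      _ = (n : ℝ) ^ (-(r * c / s)) := by
          rw [← Real.rpow_mul hn0.le]
          congr 1
          ring
      _ ≤ (n : ℝ) ^ (-C) :=
          Real.rpow_le_rpow_of_exponent_le hn1' (neg_le_neg (by
            rw [le_div_iff₀ hs0]
            linarith))
  linarith
end

section
/- Let α > 0 and let (α_n)_{n≥1} be the strictly decreasing enumeration of E^α \ {0}. Then (−log₂ α_n)/(log₂ n) → 1/α as n → ∞; that is, (α_n)_n ∈ S_{1/α}. -/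
open Filter Topology

/-- The set `E^α = {0} ∪ {(2^⌊αk⌋ + m)·2^(−k−⌊αk⌋) : k ≥ 1, 0 ≤ m < 2^⌊αk⌋}`,
i.e. `0` together with the numbers with binary expansion `0.0^(k−1) 1 j 0 0 ⋯`
where `j ∈ {0,1}^⌊αk⌋`. -/
noncomputable def Ealpha (α : ℝ) : Set ℝ :=
  {0} ∪ {x | ∃ k : ℕ, 1 ≤ k ∧ ∃ m : ℕ, m < 2 ^ ⌊α * k⌋₊ ∧
    x = ((2 : ℝ) ^ ⌊α * k⌋₊ + (m : ℝ)) * (2 : ℝ) ^ (-(k : ℝ) - (⌊α * k⌋₊ : ℝ))}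

/-- The `m`-th point of `E^α` in the dyadic interval `[2^(-k), 2^(1-k))`. -/
noncomputable def EalphaPoint (α : ℝ) (k m : ℕ) : ℝ :=
  ((2 : ℝ) ^ ⌊α * k⌋₊ + (m : ℝ)) * (2 : ℝ) ^ (-(k : ℝ) - (⌊α * k⌋₊ : ℝ))

lemma EalphaPoint_eq (α : ℝ) (k m : ℕ) :
    EalphaPoint α k m = (2 : ℝ) ^ (-(k : ℝ)) * (1 + m / (2 : ℝ) ^ ⌊α * k⌋₊) := by
  have h : (2 : ℝ) ^ ⌊α * k⌋₊ ≠ 0 := by positivity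
  rw [EalphaPoint, Real.rpow_sub two_pos, Real.rpow_natCast]
  field_simp

lemma le_EalphaPoint (α : ℝ) (k m : ℕ) : (2 : ℝ) ^ (-(k : ℝ)) ≤ EalphaPoint α k m := by
  rw [EalphaPoint_eq]
  exact le_mul_of_one_le_right (by positivity) (le_add_of_nonneg_right (by positivity))

lemma EalphaPoint_pos (α : ℝ) (k m : ℕ) : 0 < EalphaPoint α k m :=
  lt_of_lt_of_le (by positivity) (le_EalphaPoint α k m)

lemma EalphaPoint_lt {α : ℝ} {k m : ℕ} (hm : m < 2 ^ ⌊α * k⌋₊) :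
    EalphaPoint α k m < (2 : ℝ) ^ (1 - (k : ℝ)) := by
  have h : (m : ℝ) / (2 : ℝ) ^ ⌊α * k⌋₊ < 1 := by
    rw [div_lt_one (by positivity)]
    exact_mod_cast hm
  have h2 : (2 : ℝ) ^ (1 - (k : ℝ)) = (2 : ℝ) ^ (-(k : ℝ)) * 2 := by
    rw [sub_eq_add_neg, Real.rpow_add two_pos, Real.rpow_one, mul_comm]
  rw [EalphaPoint_eq, h2]
  exact mul_lt_mul_of_pos_left (by linarith) (by positivity)

lemma EalphaPoint_injective (α : ℝ) (k : ℕ) : Function.Injective (EalphaPoint α k) := by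
  intro m m' h
  have h2 : (2 : ℝ) ^ (-(k : ℝ) - (⌊α * k⌋₊ : ℝ)) ≠ 0 := by positivity
  simpa using mul_right_cancel₀ h2 h

lemma mem_Ealpha_diff_zero {α x : ℝ} :
    x ∈ Ealpha α \ {0} ↔
      ∃ k : ℕ, 1 ≤ k ∧ ∃ m : ℕ, m < 2 ^ ⌊α * k⌋₊ ∧ x = EalphaPoint α k m := by
  constructor
  · rintro ⟨h | h, h0⟩
    · exact absurd h h0
    · exact h
  · rintro ⟨k, hk, m, hm, rfl⟩
    exact ⟨Or.inr ⟨k, hk, m, hm, rfl⟩, (EalphaPoint_pos α k m).ne'⟩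

/-- Counting the points of `E^α` on levels up to `k` bounds the index of a point on level `k`. -/
lemma enumeration_index_lt {α : ℝ} (hα : 0 < α) {a : ℕ → ℝ} (haanti : StrictAnti a)
    (hrange : Set.range a = Ealpha α \ {0}) {n k m : ℕ} (han : a n = EalphaPoint α k m) :
    n < k * 2 ^ ⌊α * k⌋₊ := by
  have hex : ∀ j, ∃ i : ℕ, 1 ≤ i ∧ ∃ l : ℕ, l < 2 ^ ⌊α * i⌋₊ ∧ a j = EalphaPoint α i l :=
    fun j => mem_Ealpha_diff_zero.1 (hrange ▸ Set.mem_range_self j)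
  choose i hi l hl hil using hex
  have hcard : (Finset.range (n + 1)).card ≤
      (Finset.Icc 1 k ×ˢ Finset.range (2 ^ ⌊α * k⌋₊)).card := by
    refine Finset.card_le_card_of_injOn (fun j => (i j, l j)) ?_ ?_
    · intro j hj
      have hj : j ≤ n := by simpa [Nat.lt_succ_iff] using hj
      have h1 : (2 : ℝ) ^ (-(k : ℝ)) < (2 : ℝ) ^ (1 - (i j : ℝ)) :=
        calc _ ≤ a n := han ▸ le_EalphaPoint α k m
          _ ≤ a j := haanti.antitone hj
          _ < _ := hil j ▸ EalphaPoint_lt (hl j)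
      have h2 := (Real.rpow_lt_rpow_left_iff one_lt_two).1 h1
      have h3 : i j < k + 1 := by
        have : (i j : ℝ) < k + 1 := by linarith
        exact_mod_cast this
      have h4 : i j ≤ k := Nat.lt_succ_iff.1 h3
      have h5 : (2 : ℕ) ^ ⌊α * i j⌋₊ ≤ 2 ^ ⌊α * k⌋₊ := by gcongr; norm_num
      simpa using ⟨⟨hi j, h4⟩, (hl j).trans_le h5⟩
    · intro j _ j' _ h
      obtain ⟨h1, h2⟩ := Prod.mk.inj h
      exact haanti.injective (by rw [hil j, hil j', h1, h2])
  simpa [Nat.succ_le_iff] using hcard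

/-- All points of `E^α` on level `k` precede the points on level `k + 1`. -/
lemma two_pow_le_enumeration_index {α : ℝ} {a : ℕ → ℝ} (haanti : StrictAnti a)
    (hrange : Set.range a = Ealpha α \ {0}) {n k m : ℕ} (hk : 1 ≤ k)
    (hm : m < 2 ^ ⌊α * (k + 1 : ℕ)⌋₊) (han : a n = EalphaPoint α (k + 1) m) :
    2 ^ ⌊α * k⌋₊ ≤ n := by
  have hex : ∀ l : ℕ, ∃ j, l < 2 ^ ⌊α * k⌋₊ → a j = EalphaPoint α k l := by
    intro l
    by_cases hl : l < 2 ^ ⌊α * k⌋₊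
    · obtain ⟨j, hj⟩ : EalphaPoint α k l ∈ Set.range a :=
        hrange ▸ mem_Ealpha_diff_zero.2 ⟨k, hk, l, hl, rfl⟩
      exact ⟨j, fun _ => hj⟩
    · exact ⟨0, fun h => absurd h hl⟩
  choose j hj using hex
  have hcard : (Finset.range (2 ^ ⌊α * k⌋₊)).card ≤ (Finset.range n).card := by
    refine Finset.card_le_card_of_injOn j ?_ ?_
    · intro l hl
      have hl : l < 2 ^ ⌊α * k⌋₊ := by simpa using hl
      have h1 : a n < a (j l) := by
        rw [hj l hl, han]
        refine (EalphaPoint_lt hm).trans_le (le_trans (le_of_eq ?_) (le_EalphaPoint α k l))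
        push_cast
        ring_nf
      simpa using haanti.lt_iff_gt.1 h1
    · intro l hl l' hl' h
      have hl : l < 2 ^ ⌊α * k⌋₊ := by simpa using hl
      have hl' : l' < 2 ^ ⌊α * k⌋₊ := by simpa using hl'
      exact EalphaPoint_injective α k (by rw [← hj l hl, ← hj l' hl', h])
  simpa using hcard

lemma tendsto_logb_natCast_div_atTop :
    Tendsto (fun k : ℕ => Real.logb 2 k / (k : ℝ)) atTop (𝓝 0) := by
  have h := (Real.isLittleO_log_id_atTop.tendsto_div_nhds_zero.comp
    (tendsto_natCast_atTop_atTop (R := ℝ))).div_const (Real.log 2)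
  rw [zero_div] at h
  refine h.congr fun k => ?_
  simp only [Function.comp, id, Real.logb]
  ring

/-- If `(α_n)` is the strictly decreasing enumeration of `E^α \ {0}`, then
`(−log₂ α_n)/(log₂ n) → 1/α`, i.e. `(α_n) ∈ S_{1/α}`. -/
theorem Ealpha_enumeration_mem_S
    (α : ℝ) (hα : 0 < α) (a : ℕ → ℝ) (haanti : StrictAnti a)
    (hrange : Set.range a = Ealpha α \ {0}) :
    Tendsto (fun n : ℕ => (-Real.logb 2 (a n)) / Real.logb 2 n) atTop (𝓝 (1 / α)) := by
  have hex : ∀ n, ∃ k : ℕ, 1 ≤ k ∧ ∃ m : ℕ, m < 2 ^ ⌊α * k⌋₊ ∧ a n = EalphaPoint α k m :=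
    fun n => mem_Ealpha_diff_zero.1 (hrange ▸ Set.mem_range_self n)
  choose k hk m hm hkm using hex
  have hlt : ∀ n, n < k n * 2 ^ ⌊α * k n⌋₊ := fun n =>
    enumeration_index_lt hα haanti hrange (hkm n)
  have hk_top : Tendsto k atTop atTop := by
    refine tendsto_atTop.2 fun K => ?_
    filter_upwards [eventually_ge_atTop (K * 2 ^ ⌊α * K⌋₊)] with n hn
    by_contra! hK
    have : k n * 2 ^ ⌊α * k n⌋₊ ≤ K * 2 ^ ⌊α * K⌋₊ := by gcongr; norm_num
    exact absurd (hlt n) (by omega)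
  have hinv : Tendsto (fun k : ℕ => ((k : ℝ))⁻¹) atTop (𝓝 0) :=
    tendsto_inv_atTop_nhds_zero_nat
  have hlog_a : Tendsto (fun n => (-Real.logb 2 (a n)) / (k n : ℝ)) atTop (𝓝 1) := by
    have hlow : Tendsto (fun n => 1 - ((k n : ℝ))⁻¹) atTop (𝓝 1) := by
      simpa using (hinv.comp hk_top).const_sub 1
    refine tendsto_of_tendsto_of_tendsto_of_le_of_le hlow tendsto_const_nhds ?_ ?_
    · intro n
      have hkpos : (0 : ℝ) < k n := by exact_mod_cast hk n
      have h := (Real.logb_lt_iff_lt_rpow one_lt_two (hkm n ▸ EalphaPoint_pos α _ _)).2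
        (hkm n ▸ EalphaPoint_lt (hm n))
      simp only
      rw [le_div_iff₀ hkpos, sub_mul, inv_mul_cancel₀ hkpos.ne']
      linarith
    · intro n
      have hkpos : (0 : ℝ) < k n := by exact_mod_cast hk n
      have h := (Real.le_logb_iff_rpow_le one_lt_two (hkm n ▸ EalphaPoint_pos α _ _)).2
        (hkm n ▸ le_EalphaPoint α (k n) (m n))
      simp only
      rw [div_le_one hkpos]
      linarith
  have hlog_n : Tendsto (fun n : ℕ => Real.logb 2 n / (k n : ℝ)) atTop (𝓝 α) := by
    have hlow : Tendsto (fun n => α - (α + 1) * ((k n : ℝ))⁻¹) atTop (𝓝 α) := by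
      simpa using ((hinv.comp hk_top).const_mul (α + 1)).const_sub α
    have hup : Tendsto (fun n => α + Real.logb 2 (k n) / (k n : ℝ)) atTop (𝓝 α) := by
      simpa using (tendsto_logb_natCast_div_atTop.comp hk_top).const_add α
    refine tendsto_of_tendsto_of_tendsto_of_le_of_le' hlow hup ?_ ?_
    · filter_upwards [hk_top.eventually_ge_atTop 2] with n hn
      have hkpos : (0 : ℝ) < k n := by exact_mod_cast hk n
      obtain ⟨i, hi⟩ : ∃ i, k n = i + 1 := ⟨k n - 1, by omega⟩
      have hle : 2 ^ ⌊α * i⌋₊ ≤ n :=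
        two_pow_le_enumeration_index haanti hrange (by omega) (hi ▸ hm n) (hi ▸ hkm n)
      have hle' : (2 : ℝ) ^ (⌊α * i⌋₊ : ℝ) ≤ n := by
        rw [Real.rpow_natCast]
        exact_mod_cast hle
      have hlog := (Real.le_logb_iff_rpow_le one_lt_two
        (lt_of_lt_of_le (by positivity) hle')).2 hle'
      have hfl := Nat.lt_floor_add_one (α * i)
      have hi' : (k n : ℝ) = i + 1 := by exact_mod_cast hi
      rw [le_div_iff₀ hkpos, sub_mul, mul_assoc, inv_mul_cancel₀ hkpos.ne', hi']
      linarith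
    · filter_upwards [eventually_ge_atTop 1] with n hn
      have hkpos : (0 : ℝ) < k n := by exact_mod_cast hk n
      have hnpos : (0 : ℝ) < n := by exact_mod_cast hn
      have hle : (n : ℝ) ≤ k n * (2 : ℝ) ^ ⌊α * k n⌋₊ := by exact_mod_cast (hlt n).le
      have hlog := Real.logb_le_logb_of_le one_lt_two hnpos hle
      rw [Real.logb_mul hkpos.ne' (by positivity), ← Real.rpow_natCast,
        Real.logb_rpow two_pos (by norm_num)] at hlog
      have hfl := Nat.floor_le (show 0 ≤ α * k n by positivity)
      rw [div_le_iff₀ hkpos, add_mul, div_mul_cancel₀ _ hkpos.ne']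
      linarith
  refine (hlog_a.div hlog_n hα.ne').congr fun n => ?_
  have hkpos : (0 : ℝ) < k n := by exact_mod_cast hk n
  exact div_div_div_cancel_right₀ hkpos.ne' _ _
end

section
/- Let α > 0. Then the box-counting dimension of the set E^α exists and equals α/(1 + α). -/
open Filter Topology
open scoped ENNReal

/-- The point of `Ealpha α` with level `k` and offset `m`. -/
noncomputable def ealphaPoint (α : ℝ) (k m : ℕ) : ℝ :=
  ((2 : ℝ) ^ ⌊α * k⌋₊ + (m : ℝ)) * (2 : ℝ) ^ (-(k : ℝ) - (⌊α * k⌋₊ : ℝ))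

lemma ealphaPoint_nonneg (α : ℝ) (k m : ℕ) : 0 ≤ ealphaPoint α k m := by
  unfold ealphaPoint; positivity

lemma ealphaPoint_le (α : ℝ) {k m : ℕ} (hm : m < 2 ^ ⌊α * k⌋₊) :
    ealphaPoint α k m ≤ (2 : ℝ) ^ (1 - (k : ℝ)) := by
  have hm' : (m : ℝ) ≤ 2 ^ ⌊α * k⌋₊ := by exact_mod_cast hm.le
  have h1 : (2 : ℝ) ^ (1 - (k : ℝ)) =
      (2 ^ ⌊α * k⌋₊ + 2 ^ ⌊α * k⌋₊) * (2 : ℝ) ^ (-(k : ℝ) - (⌊α * k⌋₊ : ℝ)) := by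
    have h2 : 1 - (k : ℝ) = 1 + ((⌊α * k⌋₊ : ℝ) + (-(k : ℝ) - (⌊α * k⌋₊ : ℝ))) := by ring
    rw [h2, Real.rpow_add two_pos, Real.rpow_add two_pos, Real.rpow_one, Real.rpow_natCast]
    ring
  rw [h1, ealphaPoint]
  gcongr

/-- Distinct points of the same level are separated by the mesh of that level. -/
lemma lt_abs_ealphaPoint_sub (α : ℝ) {r : ℝ} {k m n : ℕ}
    (hr : r < (2 : ℝ) ^ (-(k : ℝ) - (⌊α * k⌋₊ : ℝ))) (hmn : m ≠ n) :
    r < |ealphaPoint α k m - ealphaPoint α k n| := by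
  have h1 : (1 : ℝ) ≤ |(m : ℝ) - n| := by
    have : (1 : ℤ) ≤ |(m : ℤ) - n| := Int.one_le_abs (by omega)
    exact_mod_cast this
  have hp : (0 : ℝ) < (2 : ℝ) ^ (-(k : ℝ) - (⌊α * k⌋₊ : ℝ)) := by positivity
  have h2 : ealphaPoint α k m - ealphaPoint α k n =
      ((m : ℝ) - n) * (2 : ℝ) ^ (-(k : ℝ) - (⌊α * k⌋₊ : ℝ)) := by
    unfold ealphaPoint; ring
  rw [h2, abs_mul, abs_of_pos hp]
  nlinarith

lemma two_pow_floor_le {α : ℝ} (hα : 0 ≤ α) {k : ℕ} {t : ℝ} (hk : (k : ℝ) ≤ t) :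
    (2 : ℝ) ^ ⌊α * k⌋₊ ≤ (2 : ℝ) ^ (α * t) := by
  rw [← Real.rpow_natCast]
  refine Real.rpow_le_rpow_of_exponent_le one_le_two ?_
  exact (Nat.floor_le (by positivity)).trans (by gcongr)

/-- `Ealpha α` is covered by intervals of length `r` near the origin together with singletons. -/
lemma exists_cover_Ealpha {α t r : ℝ} (hα : 0 < α) (ht : 0 ≤ t)
    (hr : r = (2 : ℝ) ^ (-((1 + α) * t))) :
    ∃ 𝒰 : Finset (Set ℝ), (𝒰.card : ℝ) ≤ (t + 4) * (2 : ℝ) ^ (α * t) ∧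
      (Ealpha α ⊆ ⋃ U ∈ 𝒰, U) ∧ ∀ U ∈ 𝒰, Metric.ediam U ≤ ENNReal.ofReal r := by
  classical
  have hr0 : 0 < r := hr ▸ by positivity
  set K := ⌊t⌋₊ with hK
  have hKt : (K : ℝ) ≤ t := Nat.floor_le ht
  have htK : t < K + 1 := Nat.lt_floor_add_one t
  set J := ⌊(2 : ℝ) ^ (-(K : ℝ)) / r⌋₊ with hJ
  let 𝒜 : Finset (Set ℝ) :=
    (Finset.range (J + 1)).image fun j : ℕ => Set.Icc (j * r) ((j + 1) * r)
  let ℬ : Finset (Set ℝ) :=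
    (Finset.range (K + 1)).biUnion fun k =>
      (Finset.range (2 ^ ⌊α * k⌋₊)).image fun m => {ealphaPoint α k m}
  have hsmall : ∀ x : ℝ, 0 ≤ x → x ≤ (2 : ℝ) ^ (-(K : ℝ)) → ∃ U ∈ 𝒜 ∪ ℬ, x ∈ U := by
    intro x hx0 hx
    refine ⟨_, Finset.mem_union_left _ (Finset.mem_image_of_mem _ (a := ⌊x / r⌋₊) ?_), ?_⟩
    · rw [Finset.mem_range, Nat.lt_succ_iff]
      exact Nat.floor_le_floor (by gcongr)
    · have h1 := Nat.floor_le (div_nonneg hx0 hr0.le)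
      have h2 := (Nat.lt_floor_add_one (x / r)).le
      exact ⟨(le_div_iff₀ hr0).1 h1, (div_le_iff₀ hr0).1 h2⟩
  refine ⟨𝒜 ∪ ℬ, ?_, ?_, ?_⟩
  · have hA : (𝒜.card : ℝ) ≤ 2 * (2 : ℝ) ^ (α * t) + 1 := by
      have h1 : (𝒜.card : ℝ) ≤ J + 1 := by
        exact_mod_cast Finset.card_image_le.trans (Finset.card_range _).le
      have h2 : (J : ℝ) ≤ (2 : ℝ) ^ (-(K : ℝ)) / r := Nat.floor_le (by positivity)
      have h3 : (2 : ℝ) ^ (-(K : ℝ)) / r ≤ 2 * (2 : ℝ) ^ (α * t) := by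
        rw [hr, ← Real.rpow_sub two_pos]
        nth_rewrite 2 [← Real.rpow_one 2]
        rw [← Real.rpow_add two_pos]
        exact Real.rpow_le_rpow_of_exponent_le one_le_two (by linarith)
      linarith
    have hB : (ℬ.card : ℝ) ≤ (t + 1) * (2 : ℝ) ^ (α * t) := by
      have h1 : ℬ.card ≤ ∑ k ∈ Finset.range (K + 1), 2 ^ ⌊α * k⌋₊ :=
        Finset.card_biUnion_le.trans <| Finset.sum_le_sum fun k _ =>
          Finset.card_image_le.trans (Finset.card_range _).le
      have h2 : (ℬ.card : ℝ) ≤ ∑ k ∈ Finset.range (K + 1), (2 : ℝ) ^ ⌊α * k⌋₊ := by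
        exact_mod_cast h1
      have h3 : ∑ k ∈ Finset.range (K + 1), (2 : ℝ) ^ ⌊α * k⌋₊ ≤
          ∑ k ∈ Finset.range (K + 1), (2 : ℝ) ^ (α * t) := by
        refine Finset.sum_le_sum fun k hk => two_pow_floor_le hα.le ?_
        have : (k : ℝ) ≤ K := by exact_mod_cast Finset.mem_range_succ_iff.1 hk
        linarith
      rw [Finset.sum_const, Finset.card_range, nsmul_eq_mul] at h3
      refine (h2.trans h3).trans ?_
      push_cast
      gcongr
    have hU : ((𝒜 ∪ ℬ).card : ℝ) ≤ 𝒜.card + ℬ.card := by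
      exact_mod_cast Finset.card_union_le _ _
    have h1 : (1 : ℝ) ≤ (2 : ℝ) ^ (α * t) :=
      Real.one_le_rpow one_le_two (by positivity)
    linarith
  · intro x hx
    simp only [Set.mem_iUnion, exists_prop]
    rcases hx with hx | ⟨k, -, m, hm, hx⟩
    · rw [Set.mem_singleton_iff] at hx
      exact hsmall x hx.ge (hx ▸ by positivity)
    · change x = ealphaPoint α k m at hx
      rcases le_or_gt k K with hk | hk
      · refine ⟨{ealphaPoint α k m}, Finset.mem_union_right _ ?_, hx⟩
        exact Finset.mem_biUnion.2 ⟨k, Finset.mem_range_succ_iff.2 hk,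
          Finset.mem_image_of_mem _ (Finset.mem_range.2 hm)⟩
      · refine hsmall x (hx ▸ ealphaPoint_nonneg α k m) (hx ▸ (ealphaPoint_le α hm).trans ?_)
        have : (K : ℝ) + 1 ≤ k := by exact_mod_cast hk
        exact Real.rpow_le_rpow_of_exponent_le one_le_two (by linarith)
  · intro U hU
    rcases Finset.mem_union.1 hU with hU | hU
    · obtain ⟨j, -, rfl⟩ := Finset.mem_image.1 hU
      refine (Real.ediam_Icc _ _).le.trans (ENNReal.ofReal_le_ofReal ?_)
      linarith
    · obtain ⟨k, -, hU⟩ := Finset.mem_biUnion.1 hU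
      obtain ⟨m, -, rfl⟩ := Finset.mem_image.1 hU
      exact Metric.ediam_singleton.le.trans zero_le

/-- A cover by sets of diameter at most `r` has at least as many members as an `r`-separated
family. -/
lemma card_le_card_of_separated {ι : Type*} {r : ℝ} (hr : 0 ≤ r) {s : Finset ι} {p : ι → ℝ}
    {𝒰 : Finset (Set ℝ)} (hcov : ∀ i ∈ s, p i ∈ ⋃ U ∈ 𝒰, U)
    (hdiam : ∀ U ∈ 𝒰, Metric.ediam U ≤ ENNReal.ofReal r)
    (hsep : ∀ i ∈ s, ∀ j ∈ s, i ≠ j → r < |p i - p j|) : s.card ≤ 𝒰.card := by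
  have h : ∀ i, ∃ U, i ∈ s → U ∈ 𝒰 ∧ p i ∈ U := fun i => by
    by_cases hi : i ∈ s
    · simpa [hi] using hcov i hi
    · simp [hi]
  choose f hf using h
  refine Finset.card_le_card_of_injOn f (fun i hi => (hf i hi).1) fun i hi j hj hij => ?_
  by_contra hne
  have h1 := (Metric.edist_le_ediam_of_mem (hf i hi).2 (hij ▸ (hf j hj).2)).trans
    (hdiam _ (hf i hi).1)
  rw [edist_dist, ENNReal.ofReal_le_ofReal_iff hr, Real.dist_eq] at h1
  exact (hsep i hi j hj hne).not_ge h1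

lemma coveringNumber_Ealpha_le {α t r : ℝ} (hα : 0 < α) (ht : 0 ≤ t)
    (hr : r = (2 : ℝ) ^ (-((1 + α) * t))) :
    (coveringNumber r (Ealpha α) : ℝ) ≤ (t + 4) * (2 : ℝ) ^ (α * t) := by
  obtain ⟨𝒰, hcard, hcov⟩ := exists_cover_Ealpha hα ht hr
  have : coveringNumber r (Ealpha α) ≤ 𝒰.card := Nat.sInf_le ⟨𝒰, rfl, hcov⟩
  exact le_trans (by exact_mod_cast this) hcard

lemma le_coveringNumber_Ealpha {α t r : ℝ} (hα : 0 < α) (ht : 2 ≤ t)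
    (hr : r = (2 : ℝ) ^ (-((1 + α) * t))) :
    (2 : ℝ) ^ (α * t - 2 * α - 1) ≤ coveringNumber r (Ealpha α) := by
  have hr0 : 0 < r := hr ▸ by positivity
  obtain ⟨𝒱, -, h𝒱⟩ := exists_cover_Ealpha hα (by linarith) hr
  obtain ⟨𝒰, hcard, hcov, hdiam⟩ := Nat.sInf_mem (s := {n : ℕ | ∃ 𝒰 : Finset (Set ℝ),
    𝒰.card = n ∧ (Ealpha α ⊆ ⋃ U ∈ 𝒰, U) ∧ ∀ U ∈ 𝒰, Metric.ediam U ≤ ENNReal.ofReal r})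
    ⟨_, 𝒱, rfl, h𝒱⟩
  change 𝒰.card = coveringNumber r (Ealpha α) at hcard
  set K := ⌊t - 1⌋₊ with hK
  have hK1 : 1 ≤ K := Nat.le_floor (by push_cast; linarith)
  have hKt : (K : ℝ) ≤ t - 1 := Nat.floor_le (by linarith)
  have htK : t - 1 < K + 1 := Nat.lt_floor_add_one _
  have hfle : (⌊α * K⌋₊ : ℝ) ≤ α * K := Nat.floor_le (by positivity)
  have hltf : α * K < ⌊α * K⌋₊ + 1 := Nat.lt_floor_add_one _
  have hsep : r < (2 : ℝ) ^ (-(K : ℝ) - (⌊α * K⌋₊ : ℝ)) := by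
    rw [hr]
    exact Real.rpow_lt_rpow_of_exponent_lt one_lt_two (by nlinarith)
  have hle : (Finset.range (2 ^ ⌊α * K⌋₊)).card ≤ 𝒰.card :=
    card_le_card_of_separated (p := ealphaPoint α K) hr0.le
      (fun m hm => hcov (Or.inr ⟨K, hK1, m, Finset.mem_range.1 hm, rfl⟩)) hdiam
      fun m _ n _ hmn => lt_abs_ealphaPoint_sub α hsep hmn
  rw [Finset.card_range, hcard] at hle
  calc (2 : ℝ) ^ (α * t - 2 * α - 1) ≤ (2 : ℝ) ^ (⌊α * K⌋₊ : ℝ) :=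
        Real.rpow_le_rpow_of_exponent_le one_le_two (by nlinarith)
    _ = (2 ^ ⌊α * K⌋₊ : ℕ) := by rw [Real.rpow_natCast]; push_cast; rfl
    _ ≤ coveringNumber r (Ealpha α) := by exact_mod_cast hle

lemma tendsto_log_coveringNumber_Ealpha {α : ℝ} (hα : 0 < α) :
    Tendsto (fun r : ℝ => Real.log (coveringNumber r (Ealpha α)) / (-Real.log r))
      (𝓝[>] 0) (𝓝 (α / (1 + α))) := by
  have hl : 0 < Real.log 2 := Real.log_pos one_lt_two
  have hα1 : 0 < 1 + α := by linarith
  have hc : 0 < (1 + α) * Real.log 2 := by positivity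
  let T : ℝ → ℝ := fun r => -Real.log r / ((1 + α) * Real.log 2)
  have hT : Tendsto T (𝓝[>] 0) atTop :=
    (tendsto_neg_atBot_atTop.comp Real.tendsto_log_nhdsGT_zero).atTop_div_const hc
  have hinv : Tendsto (fun t : ℝ => t⁻¹) atTop (𝓝 0) := tendsto_inv_atTop_zero
  have hlow : Tendsto (fun t : ℝ => α / (1 + α) - (2 * α + 1) / (1 + α) * t⁻¹) atTop
      (𝓝 (α / (1 + α))) := by
    simpa using tendsto_const_nhds.sub (hinv.const_mul ((2 * α + 1) / (1 + α)))
  have hlog : Tendsto (fun t : ℝ => Real.log (t + 4) / t) atTop (𝓝 0) := by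
    have h := (Real.isLittleO_log_id_atTop.tendsto_div_nhds_zero.comp
      (tendsto_atTop_add_const_right atTop (4 : ℝ) tendsto_id)).mul
        ((hinv.const_mul 4).const_add 1)
    simp only [mul_zero, zero_mul] at h
    refine h.congr' ?_
    filter_upwards [eventually_gt_atTop 0] with t ht
    have : t + 4 ≠ 0 := by positivity
    simp only [Function.comp, id]
    field_simp
  have hup : Tendsto (fun t : ℝ => α / (1 + α) + Real.log (t + 4) / t / ((1 + α) * Real.log 2))
      atTop (𝓝 (α / (1 + α))) := by
    simpa using (hlog.div_const ((1 + α) * Real.log 2)).const_add (α / (1 + α))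
  have hrT : ∀ r : ℝ, 0 < r → r = (2 : ℝ) ^ (-((1 + α) * T r)) := fun r hr => by
    rw [Real.rpow_def_of_pos two_pos]
    have : Real.log 2 * -((1 + α) * T r) = Real.log r := by
      simp only [T]; field_simp
    rw [this, Real.exp_log hr]
  refine tendsto_of_tendsto_of_tendsto_of_le_of_le' (hlow.comp hT) (hup.comp hT) ?_ ?_
  · filter_upwards [hT.eventually_ge_atTop 2, self_mem_nhdsWithin] with r ht hr
    have hlogr : -Real.log r = (1 + α) * Real.log 2 * T r := by simp only [T]; field_simp
    have ht0 : 0 < T r := by linarith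
    have h := Real.log_le_log (by positivity) (le_coveringNumber_Ealpha hα ht (hrT r hr))
    rw [Real.log_rpow two_pos] at h
    rw [hlogr, le_div_iff₀ (by positivity)]
    refine le_trans (le_of_eq ?_) h
    simp only [Function.comp]
    field_simp
    ring
  · filter_upwards [hT.eventually_ge_atTop 2, self_mem_nhdsWithin] with r ht hr
    have hlogr : -Real.log r = (1 + α) * Real.log 2 * T r := by simp only [T]; field_simp
    have ht0 : 0 < T r := by linarith
    have hpos : (0 : ℝ) < coveringNumber r (Ealpha α) :=
      lt_of_lt_of_le (by positivity) (le_coveringNumber_Ealpha hα ht (hrT r hr))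
    have h := Real.log_le_log hpos (coveringNumber_Ealpha_le hα ht0.le (hrT r hr))
    rw [Real.log_mul (by positivity) (by positivity), Real.log_rpow two_pos] at h
    rw [hlogr, div_le_iff₀ (by positivity)]
    refine h.trans (le_of_eq ?_)
    simp only [Function.comp]
    field_simp
    ring

/-- For `α > 0`, the box-counting dimension of `E^α` exists and equals `α/(1+α)`. -/
theorem boxDim_Ealpha (α : ℝ) (hα : 0 < α) :
    lowerBoxDim (Ealpha α) = α / (1 + α) ∧ upperBoxDim (Ealpha α) = α / (1 + α) := by
  have h := tendsto_log_coveringNumber_Ealpha hα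
  exact ⟨h.liminf_eq, h.limsup_eq⟩
end

section
/- Let W be a positive random variable, not almost surely constant, with E(W) = 1, E(W^t) < ∞ for all t > 0, and E(W^{−u}) < ∞ for some u > 0. Define φ(β) = sup_{x > 0} (1 + inf_{t > 0}(x t + log₂ E(W^t)))/(1 + x + β) for β ≥ 0. Then φ is strictly decreasing and continuous on [0, ∞). -/
open MeasureTheory Filter Topology

/-- The normalized supremum attached to a profile `g` on `(0, ∞)`. -/
noncomputable def supRatio (g : ℝ → ℝ) (β : ℝ) : ℝ :=
  sSup {y : ℝ | ∃ x : ℝ, 0 < x ∧ y = g x / (1 + x + β)}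

section supRatio

variable {g : ℝ → ℝ}

theorem div_le_one_of_profile_le_one (hg : ∀ x, 0 < x → g x ≤ 1) {β x : ℝ} (hβ : 0 ≤ β)
    (hx : 0 < x) : g x / (1 + x + β) ≤ 1 := by
  rw [div_le_one (by positivity)]
  linarith [hg x hx]

theorem le_supRatio (hg : ∀ x, 0 < x → g x ≤ 1) {β x : ℝ} (hβ : 0 ≤ β) (hx : 0 < x) :
    g x / (1 + x + β) ≤ supRatio g β := by
  refine le_csSup ⟨1, ?_⟩ ⟨x, hx, rfl⟩
  rintro y ⟨z, hz, rfl⟩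
  exact div_le_one_of_profile_le_one hg hβ hz

theorem supRatio_le {β c : ℝ} (h : ∀ x, 0 < x → g x / (1 + x + β) ≤ c) : supRatio g β ≤ c := by
  refine csSup_le ⟨_, 1, one_pos, rfl⟩ ?_
  rintro y ⟨x, hx, rfl⟩
  exact h x hx

theorem supRatio_pos (hg : ∀ x, 0 < x → g x ≤ 1) {x₀ : ℝ} (hx₀ : 0 < x₀) (hgx₀ : 1 ≤ g x₀)
    {β : ℝ} (hβ : 0 ≤ β) : 0 < supRatio g β :=
  (div_pos (by linarith) (by positivity)).trans_le (le_supRatio hg hβ hx₀)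

theorem strictAntiOn_supRatio (hg : ∀ x, 0 < x → g x ≤ 1) {x₀ : ℝ} (hx₀ : 0 < x₀)
    (hgx₀ : 1 ≤ g x₀) : StrictAntiOn (supRatio g) (Set.Ici 0) := by
  intro a ha b hb hab
  rw [Set.mem_Ici] at ha hb
  have hpos := supRatio_pos hg hx₀ hgx₀ ha
  have hbound : supRatio g b ≤ (1 + x₀ + a) / (1 + x₀ + b) * supRatio g a := by
    refine supRatio_le fun x hx => ?_
    rcases le_or_gt (g x) 0 with h | h
    · exact (div_nonpos_of_nonpos_of_nonneg h (by positivity)).trans (by positivity)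
    · rcases le_or_gt x x₀ with hxx | hxx
      · calc g x / (1 + x + b) = (1 + x + a) / (1 + x + b) * (g x / (1 + x + a)) := by
              field_simp
          _ ≤ (1 + x₀ + a) / (1 + x₀ + b) * (g x / (1 + x + a)) := by
              gcongr ?_ * _
              rw [div_le_div_iff₀ (by positivity) (by positivity)]
              nlinarith
          _ ≤ _ := by
              gcongr
              exact le_supRatio hg ha hx
      · calc g x / (1 + x + b) ≤ g x₀ / (1 + x₀ + b) := by
              gcongr
              exact (hg x hx).trans hgx₀
          _ = (1 + x₀ + a) / (1 + x₀ + b) * (g x₀ / (1 + x₀ + a)) := by field_simp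
          _ ≤ _ := by
              gcongr
              exact le_supRatio hg ha hx₀
  refine hbound.trans_lt (mul_lt_of_lt_one_left hpos ?_)
  rw [div_lt_one (by positivity)]
  linarith

theorem lipschitzOnWith_supRatio (hg : ∀ x, 0 < x → g x ≤ 1) {x₀ : ℝ} (hx₀ : 0 < x₀)
    (hgx₀ : 1 ≤ g x₀) : LipschitzOnWith 1 (supRatio g) (Set.Ici 0) := by
  refine LipschitzOnWith.of_le_add_mul 1 fun a ha b hb => ?_
  rw [NNReal.coe_one, one_mul]
  rcases le_total b a with hba | hab
  · exact ((strictAntiOn_supRatio hg hx₀ hgx₀).antitoneOn hb ha hba).trans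
      (le_add_of_nonneg_right dist_nonneg)
  rw [Set.mem_Ici] at ha hb
  rw [dist_comm, Real.dist_eq, abs_of_nonneg (sub_nonneg.2 hab)]
  have hpos := supRatio_pos hg hx₀ hgx₀ hb
  have hle : supRatio g b ≤ 1 :=
    supRatio_le fun x hx => div_le_one_of_profile_le_one hg hb hx
  have hbound : supRatio g a ≤ (1 + b) / (1 + a) * supRatio g b := by
    refine supRatio_le fun x hx => ?_
    rcases le_or_gt (g x) 0 with h | h
    · exact (div_nonpos_of_nonpos_of_nonneg h (by positivity)).trans (by positivity)
    · calc g x / (1 + x + a) = (1 + x + b) / (1 + x + a) * (g x / (1 + x + b)) := by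
            field_simp
        _ ≤ (1 + b) / (1 + a) * (g x / (1 + x + b)) := by
            gcongr ?_ * _
            rw [div_le_div_iff₀ (by positivity) (by positivity)]
            nlinarith
        _ ≤ _ := by
            gcongr
            exact le_supRatio hg hb hx
  refine hbound.trans ?_
  have hratio : (1 + b) / (1 + a) ≤ 1 + (b - a) := by
    rw [div_le_iff₀ (by positivity)]
    nlinarith
  nlinarith

end supRatio

section Moments

variable {Ω : Type*} [MeasurableSpace Ω] {μ : Measure Ω} {W : Ω → ℝ}

theorem integrable_log_of_integrable_rpow_neg (hWmeas : Measurable W) (hWpos : ∀ ω, 0 < W ω)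
    (hW : Integrable W μ) {u : ℝ} (hu : 0 < u) (hneg : Integrable (fun ω => W ω ^ (-u)) μ) :
    Integrable (fun ω => Real.log (W ω)) μ := by
  refine (hW.add (hneg.div_const u)).mono' hWmeas.log.aestronglyMeasurable
    (ae_of_all _ fun ω => ?_)
  have h₁ := Real.log_le_sub_one_of_pos (hWpos ω)
  have h₂ := Real.log_le_sub_one_of_pos (Real.rpow_pos_of_pos (hWpos ω) (-u))
  rw [Real.log_rpow (hWpos ω)] at h₂
  have h₃ : -Real.log (W ω) ≤ W ω ^ (-u) / u := by
    rw [le_div_iff₀ hu]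
    linarith
  have h₄ : 0 < W ω ^ (-u) / u := div_pos (Real.rpow_pos_of_pos (hWpos ω) _) hu
  have h₅ := hWpos ω
  rw [Real.norm_eq_abs, abs_le, Pi.add_apply]
  constructor <;> linarith

theorem exp_mul_integral_log_le_integral_rpow [IsProbabilityMeasure μ] (hWpos : ∀ ω, 0 < W ω)
    (hlog : Integrable (fun ω => Real.log (W ω)) μ) {t : ℝ}
    (ht : Integrable (fun ω => W ω ^ t) μ) :
    Real.exp (t * ∫ ω, Real.log (W ω) ∂μ) ≤ ∫ ω, W ω ^ t ∂μ := by
  set m := ∫ ω, Real.log (W ω) ∂μ with hm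
  have hint : Integrable (fun ω => t * (Real.log (W ω) - m)) μ :=
    (hlog.sub (integrable_const m)).const_mul t
  calc Real.exp (t * m)
      = ∫ ω, Real.exp (t * m) * (1 + t * (Real.log (W ω) - m)) ∂μ := by
        rw [integral_const_mul, integral_add (integrable_const _) hint, integral_const_mul,
          integral_sub hlog (integrable_const _), ← hm]
        simp
    _ ≤ ∫ ω, W ω ^ t ∂μ := by
        refine integral_mono (((integrable_const 1).add hint).const_mul _) ht fun ω => ?_
        calc Real.exp (t * m) * (1 + t * (Real.log (W ω) - m))
            ≤ Real.exp (t * m) * Real.exp (t * (Real.log (W ω) - m)) := by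
              gcongr
              linarith [Real.add_one_le_exp (t * (Real.log (W ω) - m))]
          _ = W ω ^ t := by
              rw [← Real.exp_add, Real.rpow_def_of_pos (hWpos ω)]
              ring_nf

theorem integral_rpow_le_one [IsProbabilityMeasure μ] (hWpos : ∀ ω, 0 < W ω)
    (hW : Integrable W μ)
    (hmean : ∫ ω, W ω ∂μ = 1) {t : ℝ} (ht₀ : 0 ≤ t) (ht₁ : t ≤ 1)
    (ht : Integrable (fun ω => W ω ^ t) μ) : ∫ ω, W ω ^ t ∂μ ≤ 1 := by
  have hint : Integrable (fun ω => t * (W ω - 1)) μ :=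
    (hW.sub (integrable_const 1)).const_mul t
  calc ∫ ω, W ω ^ t ∂μ ≤ ∫ ω, 1 + t * (W ω - 1) ∂μ := by
        refine integral_mono ht ((integrable_const 1).add hint) fun ω => ?_
        have h := rpow_one_add_le_one_add_mul_self (s := W ω - 1)
          (by linarith [hWpos ω]) ht₀ ht₁
        rwa [add_sub_cancel] at h
    _ = 1 := by
        rw [integral_add (integrable_const _) hint, integral_const_mul,
          integral_sub hW (integrable_const _), hmean]
        simp

end Moments

/-- **Lemma 2.6(b).** Let `W > 0`, not a.s. constant, with `E W = 1`,
`E(W^t) < ∞` for all `t > 0` and `E(W^{-u}) < ∞` for some `u > 0`. Define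
`φ β = sup_{x > 0} (1 + inf_{t > 0}(x t + log₂ E(W^t)))/(1 + x + β)` for `β ≥ 0`.
Then `φ` is strictly decreasing and continuous on `[0, ∞)`. -/
theorem phi_strictAnti_continuous
    {Ω : Type*} [MeasurableSpace Ω] (μ : Measure Ω) [IsProbabilityMeasure μ]
    (W : Ω → ℝ) (hWmeas : Measurable W) (hWpos : ∀ ω, 0 < W ω)
    (hconst : ¬ ∃ c : ℝ, ∀ᵐ ω ∂μ, W ω = c)
    (hmean : ∫ ω, W ω ∂μ = 1)
    (hmom : ∀ t : ℝ, 0 < t → Integrable (fun ω => W ω ^ t) μ)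
    (u : ℝ) (hu : 0 < u) (hnegmom : Integrable (fun ω => W ω ^ (-u)) μ)
    (φ : ℝ → ℝ)
    (hφ : ∀ β, φ β = sSup {y : ℝ | ∃ x : ℝ, 0 < x ∧
      y = (1 + sInf {z : ℝ | ∃ t : ℝ, 0 < t ∧
        z = x * t + Real.logb 2 (∫ ω, W ω ^ t ∂μ)}) / (1 + x + β)}) :
    StrictAntiOn φ (Set.Ici 0) ∧ ContinuousOn φ (Set.Ici 0) := by
  have hW : Integrable W μ := by simpa using hmom 1 one_pos
  have hlog := integrable_log_of_integrable_rpow_neg hWmeas hWpos hW hu hnegmom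
  set f : ℝ → ℝ := fun x => sInf {z : ℝ | ∃ t : ℝ, 0 < t ∧
    z = x * t + Real.logb 2 (∫ ω, W ω ^ t ∂μ)}
  have hf_nonpos : ∀ x, 0 < x → f x ≤ 0 := by
    intro x hx
    by_cases hbdd : BddBelow {z : ℝ | ∃ t : ℝ, 0 < t ∧
        z = x * t + Real.logb 2 (∫ ω, W ω ^ t ∂μ)}
    · refine le_of_forall_pos_le_add fun ε hε => ?_
      have ht : 0 < min 1 (ε / x) := lt_min one_pos (div_pos hε hx)
      refine (csInf_le hbdd ⟨min 1 (ε / x), ht, rfl⟩).trans ?_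
      have h₁ : x * min 1 (ε / x) ≤ ε := by
        rw [← le_div_iff₀' hx]
        exact min_le_right _ _
      have h₂ := Real.logb_nonpos (b := 2) one_lt_two
        (integral_nonneg fun ω => (Real.rpow_pos_of_pos (hWpos ω) (min 1 (ε / x))).le)
        (integral_rpow_le_one hWpos hW hmean ht.le (min_le_left _ _) (hmom _ ht))
      linarith
    · exact (Real.sInf_of_not_bddBelow hbdd).le
  obtain ⟨x₀, hx₀, hfx₀⟩ : ∃ x₀, 0 < x₀ ∧ 0 ≤ f x₀ := by
    refine ⟨|(∫ ω, Real.log (W ω) ∂μ) / Real.log 2| + 1, by positivity, Real.sInf_nonneg ?_⟩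
    rintro z ⟨t, ht, rfl⟩
    have h := Real.log_le_log (Real.exp_pos _)
      (exp_mul_integral_log_le_integral_rpow hWpos hlog (hmom t ht))
    rw [Real.log_exp] at h
    have h' : t * ((∫ ω, Real.log (W ω) ∂μ) / Real.log 2) ≤
        Real.logb 2 (∫ ω, W ω ^ t ∂μ) := by
      rw [Real.logb, ← mul_div_assoc]
      exact div_le_div_of_nonneg_right h (Real.log_pos one_lt_two).le
    nlinarith [neg_abs_le ((∫ ω, Real.log (W ω) ∂μ) / Real.log 2)]
  have hg : ∀ x, 0 < x → 1 + f x ≤ 1 := fun x hx => by linarith [hf_nonpos x hx]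
  have hφ' : φ = supRatio fun x => 1 + f x := funext hφ
  rw [hφ']
  exact ⟨strictAntiOn_supRatio hg hx₀ (by linarith),
    (lipschitzOnWith_supRatio hg hx₀ (by linarith)).continuousOn⟩
end

section
/- Let W be a positive random variable, not almost surely constant, with E(W) = 1 and E(W log₂ W) ≤ 1. Then the function t ↦ 2^t / E(W^t) is continuous and strictly increasing on [0,1] and maps [0,1] onto [1,2]; in particular, for every d ∈ [0,1] there is a unique s ∈ [0,1] such that 2^d = 2^s / E(W^s). -/
open MeasureTheory Filter Topology

lemma Real.rpow_lt_rpow_add_mul_log {v s t : ℝ} (hv : 0 < v) (hv1 : v ≠ 1) (hst : s < t)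
    (ht : t ≤ 1) : v ^ t < v ^ s + (t - s) * (v * Real.log v) := by
  obtain ⟨x, rfl⟩ : ∃ x, v = Real.exp x := ⟨Real.log v, (Real.exp_log hv).symm⟩
  have hx : x ≠ 0 := by rintro rfl; simp at hv1
  rw [Real.log_exp, ← Real.exp_mul, ← Real.exp_mul]
  have hlt : (s - t) * x + 1 < Real.exp ((s - t) * x) :=
    Real.add_one_lt_exp (mul_ne_zero (by linarith) hx)
  have hsplit : Real.exp (x * s) = Real.exp (x * t) * Real.exp ((s - t) * x) := by
    rw [← Real.exp_add]; ring_nf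
  have htangent := mul_lt_mul_of_pos_left hlt (Real.exp_pos (x * t))
  have hmono : 0 ≤ x * (Real.exp x - Real.exp (x * t)) := by
    rcases le_total 0 x with h | h
    · exact mul_nonneg h (sub_nonneg.2 (Real.exp_le_exp.2 (by nlinarith)))
    · exact mul_nonneg_of_nonpos_of_nonpos h
        (sub_nonpos.2 (Real.exp_le_exp.2 (by nlinarith)))
  nlinarith [mul_nonneg (sub_nonneg.2 hst.le) hmono]

lemma Real.rpow_le_one_add_self {v t : ℝ} (hv : 0 ≤ v) (ht : t ∈ Set.Icc (0 : ℝ) 1) :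
    v ^ t ≤ 1 + v := by
  rcases le_total v 1 with h | h
  · linarith [Real.rpow_le_one hv h ht.1]
  · linarith [Real.rpow_le_self_of_one_le h ht.2]

section Moments

variable {Ω : Type*} [MeasurableSpace Ω] {μ : Measure Ω} [IsProbabilityMeasure μ] {V : Ω → ℝ}

lemma MeasureTheory.Integrable.rpow_const_of_mem_Icc (hV : Measurable V) (hpos : ∀ ω, 0 < V ω)
    (hint : Integrable V μ) {t : ℝ} (ht : t ∈ Set.Icc (0 : ℝ) 1) :
    Integrable (fun ω => V ω ^ t) μ := by
  refine ((integrable_const 1).add hint).mono' (hV.pow_const t).aestronglyMeasurable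
    (ae_of_all _ fun ω => ?_)
  rw [Real.norm_of_nonneg (Real.rpow_nonneg (hpos ω).le t)]
  exact Real.rpow_le_one_add_self (hpos ω).le ht

lemma continuousOn_integral_rpow (hV : Measurable V) (hpos : ∀ ω, 0 < V ω)
    (hint : Integrable V μ) :
    ContinuousOn (fun t : ℝ => ∫ ω, V ω ^ t ∂μ) (Set.Icc 0 1) := by
  refine continuousOn_of_dominated (bound := fun ω => 1 + V ω)
    (fun t _ => (hV.pow_const t).aestronglyMeasurable) (fun t ht => ae_of_all _ fun ω => ?_)
    ((integrable_const 1).add hint)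
    (ae_of_all _ fun ω => (Real.continuous_const_rpow (hpos ω).ne').continuousOn)
  rw [Real.norm_of_nonneg (Real.rpow_nonneg (hpos ω).le t)]
  exact Real.rpow_le_one_add_self (hpos ω).le ht

lemma integral_rpow_pos (hV : Measurable V) (hpos : ∀ ω, 0 < V ω)
    (hint : Integrable V μ) {t : ℝ} (ht : t ∈ Set.Icc (0 : ℝ) 1) :
    0 < ∫ ω, V ω ^ t ∂μ := by
  have hsupp : Function.support (fun ω => V ω ^ t) = Set.univ :=
    Set.eq_univ_of_forall fun ω => (Real.rpow_pos_of_pos (hpos ω) t).ne'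
  rw [integral_pos_iff_support_of_nonneg (fun ω => Real.rpow_nonneg (hpos ω).le t)
    (hint.rpow_const_of_mem_Icc hV hpos ht), hsupp]
  simp

lemma strictAntiOn_integral_rpow (hV : Measurable V) (hpos : ∀ ω, 0 < V ω)
    (hint : Integrable V μ) (hne : ¬ ∀ᵐ ω ∂μ, V ω = 1)
    (hlog : Integrable (fun ω => V ω * Real.log (V ω)) μ)
    (hle : ∫ ω, V ω * Real.log (V ω) ∂μ ≤ 0) :
    StrictAntiOn (fun t : ℝ => ∫ ω, V ω ^ t ∂μ) (Set.Icc 0 1) := by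
  intro s hs t ht hst
  have hIs := hint.rpow_const_of_mem_Icc hV hpos hs
  have hIt := hint.rpow_const_of_mem_Icc hV hpos ht
  have hIl := hlog.const_mul (t - s)
  have hIsl : Integrable (fun ω => V ω ^ s + (t - s) * (V ω * Real.log (V ω))) μ := hIs.add hIl
  have hstrict : ∀ ω, V ω ≠ 1 → V ω ^ t < V ω ^ s + (t - s) * (V ω * Real.log (V ω)) :=
    fun ω h => Real.rpow_lt_rpow_add_mul_log (hpos ω) h hst ht.2
  have hnn : ∀ ω, V ω ^ t ≤ V ω ^ s + (t - s) * (V ω * Real.log (V ω)) := by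
    intro ω
    by_cases h : V ω = 1
    · simp [h]
    · exact (hstrict ω h).le
  have hint_le := integral_mono hIt hIsl hnn
  have hint_ne : ∫ ω, V ω ^ t ∂μ ≠ ∫ ω, V ω ^ s + (t - s) * (V ω * Real.log (V ω)) ∂μ := by
    intro heq
    rw [integral_eq_iff_of_ae_le hIt hIsl (ae_of_all _ hnn)] at heq
    exact hne (heq.mono fun ω hω => by_contra fun h => (hstrict ω h).ne hω)
  have hlt := lt_of_le_of_ne hint_le hint_ne
  rw [integral_add hIs hIl, integral_const_mul] at hlt
  have := mul_nonpos_of_nonneg_of_nonpos (sub_nonneg.2 hst.le) hle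
  change ∫ ω, V ω ^ t ∂μ < ∫ ω, V ω ^ s ∂μ
  linarith

end Moments

/-- **Benjamini–Schramm, Lemma 3.2.** Let `W > 0`, not a.s. constant, with
`E W = 1` and `E(W log₂ W) ≤ 1`. Then `t ↦ 2^t / E(W^t)` is continuous and
strictly increasing on `[0,1]` and maps `[0,1]` onto `[1,2]`; in particular for
every `d ∈ [0,1]` there is a unique `s ∈ [0,1]` with `2^d = 2^s / E(W^s)`. -/
theorem two_pow_div_moment_strictMono
    {Ω : Type*} [MeasurableSpace Ω] (μ : Measure Ω) [IsProbabilityMeasure μ]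
    (W : Ω → ℝ) (hWmeas : Measurable W) (hWpos : ∀ ω, 0 < W ω)
    (hconst : ¬ ∃ c : ℝ, ∀ᵐ ω ∂μ, W ω = c)
    (hint : Integrable W μ) (hmean : ∫ ω, W ω ∂μ = 1)
    (hint2 : Integrable (fun ω => W ω * Real.logb 2 (W ω)) μ)
    (hWlogW : ∫ ω, W ω * Real.logb 2 (W ω) ∂μ ≤ 1)
    (g : ℝ → ℝ) (hg : ∀ t, g t = (2 : ℝ) ^ t / ∫ ω, W ω ^ t ∂μ) :
    ContinuousOn g (Set.Icc 0 1) ∧ StrictMonoOn g (Set.Icc 0 1) ∧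
    g '' Set.Icc 0 1 = Set.Icc 1 2 ∧
    (∀ d ∈ Set.Icc (0 : ℝ) 1, ∃! s : ℝ, s ∈ Set.Icc (0 : ℝ) 1 ∧ (2 : ℝ) ^ d = g s) := by
  have hlog2 : 0 < Real.log 2 := Real.log_pos (by norm_num)
  have hV : Measurable fun ω => W ω / 2 := hWmeas.div_const 2
  have hpos : ∀ ω, 0 < W ω / 2 := fun ω => half_pos (hWpos ω)
  have hVint : Integrable (fun ω => W ω / 2) μ := hint.div_const 2
  have hentropy : (fun ω => W ω / 2 * Real.log (W ω / 2)) =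
      fun ω => Real.log 2 / 2 * (W ω * Real.logb 2 (W ω) - W ω) := by
    funext ω
    rw [Real.log_div (hWpos ω).ne' two_ne_zero, Real.logb]
    field_simp
  have hVlog : Integrable (fun ω => W ω / 2 * Real.log (W ω / 2)) μ := by
    rw [hentropy]
    exact (hint2.sub hint).const_mul _
  have hVle : ∫ ω, W ω / 2 * Real.log (W ω / 2) ∂μ ≤ 0 := by
    rw [hentropy, integral_const_mul, integral_sub hint2 hint, hmean]
    exact mul_nonpos_of_nonneg_of_nonpos (by positivity) (by linarith)
  have hne : ¬ ∀ᵐ ω ∂μ, W ω / 2 = 1 := fun h =>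
    hconst ⟨2, h.mono fun ω hω => by linarith⟩
  have hg' : g = fun t => (∫ ω, (W ω / 2) ^ t ∂μ)⁻¹ := by
    funext t
    simp_rw [hg, Real.div_rpow (hWpos _).le zero_le_two, integral_div, inv_div]
  have hmoment_pos : ∀ t ∈ Set.Icc (0 : ℝ) 1, 0 < ∫ ω, (W ω / 2) ^ t ∂μ :=
    fun t ht => integral_rpow_pos hV hpos hVint ht
  have hcont : ContinuousOn g (Set.Icc 0 1) := by
    rw [hg']
    exact (continuousOn_integral_rpow hV hpos hVint).inv₀ fun t ht => (hmoment_pos t ht).ne'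
  have hmono : StrictMonoOn g (Set.Icc 0 1) := by
    intro s hs t ht hst
    rw [hg']
    exact inv_strictAnti₀ (hmoment_pos t ht)
      (strictAntiOn_integral_rpow hV hpos hVint hne hVlog hVle hs ht hst)
  have hg0 : g 0 = 1 := by simp [hg]
  have hg1 : g 1 = 2 := by simp [hg, hmean]
  have himage : g '' Set.Icc 0 1 = Set.Icc 1 2 := by
    refine Set.Subset.antisymm ?_ ?_
    · simpa only [hg0, hg1] using hmono.monotoneOn.image_Icc_subset
    · simpa only [hg0, hg1] using intermediate_value_Icc zero_le_one hcont
  refine ⟨hcont, hmono, himage, fun d hd => ?_⟩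
  have hd2 : (2 : ℝ) ^ d ∈ g '' Set.Icc 0 1 := by
    rw [himage]
    exact ⟨Real.one_le_rpow one_le_two hd.1, Real.rpow_le_self_of_one_le one_le_two hd.2⟩
  obtain ⟨s, hs, hsd⟩ := hd2
  exact ⟨s, ⟨hs, hsd.symm⟩, fun r hr => hmono.injOn hr.1 hs (hr.2.symm.trans hsd.symm)⟩
end

section
/- Let p > 0 and let a = (a_n)_n ∈ S_p be a decreasing sequence with decreasing gaps. Then for every ε > 0 there exists n₀ ∈ ℕ such that for all n ≥ n₀ and all x ∈ [a_{n+1}, a_n], x^{1 + 1/p + ε} ≤ a_n − a_{n+1} ≤ x^{1 + 1/p − ε}. -/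
open Filter Topology

section DecreasingGaps

variable {a : ℕ → ℝ}

theorem antitone_gaps (hagaps : ∀ n, a (n + 1) - a (n + 2) ≤ a n - a (n + 1)) :
    Antitone fun n => a n - a (n + 1) :=
  antitone_nat_of_succ_le hagaps

theorem sub_le_nat_mul_gap (hagaps : ∀ n, a (n + 1) - a (n + 2) ≤ a n - a (n + 1)) (n k : ℕ) :
    a n - a (n + k) ≤ k * (a n - a (n + 1)) := by
  induction k with
  | zero => simp
  | succ k ih =>
    have h : a (n + k) - a (n + k + 1) ≤ a n - a (n + 1) :=
      antitone_gaps hagaps (Nat.le_add_right n k)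
    rw [← add_assoc]
    push_cast
    linarith

theorem nat_mul_gap_le_sub (hagaps : ∀ n, a (n + 1) - a (n + 2) ≤ a n - a (n + 1)) (n k : ℕ) :
    k * (a (n + k) - a (n + k + 1)) ≤ a n - a (n + k) := by
  induction k with
  | zero => simp
  | succ k ih =>
    have h : a (n + k + 1) - a (n + k + 1 + 1) ≤ a (n + k) - a (n + k + 1) :=
      antitone_gaps hagaps (Nat.le_succ (n + k))
    have h' := mul_le_mul_of_nonneg_left h (Nat.cast_nonneg (α := ℝ) k)
    rw [← add_assoc]
    push_cast
    linarith

theorem gap_pos (hapos : ∀ n, 0 < a n) (halim : Tendsto a atTop (𝓝 0))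
    (hagaps : ∀ n, a (n + 1) - a (n + 2) ≤ a n - a (n + 1)) (n : ℕ) :
    0 < a n - a (n + 1) := by
  by_contra! h
  obtain ⟨k, hk, hlt⟩ :=
    ((eventually_ge_atTop n).and (halim.eventually (gt_mem_nhds (hapos n)))).exists
  obtain ⟨j, rfl⟩ := Nat.exists_eq_add_of_le hk
  have h₁ := sub_le_nat_mul_gap hagaps n j
  have h₂ := mul_nonpos_of_nonneg_of_nonpos (Nat.cast_nonneg (α := ℝ) j) h
  linarith

end DecreasingGaps

theorem tendsto_log_natCast_atTop : Tendsto (fun n : ℕ => Real.log n) atTop atTop :=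
  Real.tendsto_log_atTop.comp tendsto_natCast_atTop_atTop

theorem eventually_log_natCast_pos : ∀ᶠ n : ℕ in atTop, 0 < Real.log n :=
  tendsto_log_natCast_atTop.eventually_gt_atTop 0

theorem tendsto_const_div_log_natCast (c : ℝ) :
    Tendsto (fun n : ℕ => c / Real.log n) atTop (𝓝 0) :=
  tendsto_const_nhds.div_atTop tendsto_log_natCast_atTop

theorem tendsto_log_half_div_log :
    Tendsto (fun n : ℕ => Real.log (n / 2 : ℕ) / Real.log n) atTop (𝓝 1) := by
  have hlow : Tendsto (fun n : ℕ => 1 - Real.log 3 / Real.log n) atTop (𝓝 1) := by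
    simpa using tendsto_const_nhds.sub (tendsto_const_div_log_natCast (Real.log 3))
  refine tendsto_of_tendsto_of_tendsto_of_le_of_le' hlow tendsto_const_nhds ?_ ?_
  · filter_upwards [eventually_log_natCast_pos, eventually_ge_atTop 2] with n hL hn
    have hhalf : (0 : ℝ) < (n / 2 : ℕ) := by exact_mod_cast (by omega : 0 < n / 2)
    have hle : (n : ℝ) ≤ 3 * (n / 2 : ℕ) := by exact_mod_cast (by omega : n ≤ 3 * (n / 2))
    have h := Real.log_le_log (by positivity) hle
    rw [Real.log_mul (by norm_num) hhalf.ne'] at h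
    rw [le_div_iff₀ hL, sub_mul, div_mul_cancel₀ _ hL.ne']
    linarith
  · filter_upwards [eventually_log_natCast_pos, eventually_ge_atTop 2] with n hL hn
    have hhalf : (0 : ℝ) < (n / 2 : ℕ) := by exact_mod_cast (by omega : 0 < n / 2)
    rw [div_le_one hL]
    exact Real.log_le_log hhalf (by exact_mod_cast Nat.div_le_self n 2)

theorem tendsto_log_div_log_succ :
    Tendsto (fun n : ℕ => Real.log (n + 1 : ℕ) / Real.log n) atTop (𝓝 1) := by
  have hup : Tendsto (fun n : ℕ => 1 + Real.log 2 / Real.log n) atTop (𝓝 1) := by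
    simpa using tendsto_const_nhds.add (tendsto_const_div_log_natCast (Real.log 2))
  refine tendsto_of_tendsto_of_tendsto_of_le_of_le' tendsto_const_nhds hup ?_ ?_
  · filter_upwards [eventually_log_natCast_pos, eventually_ge_atTop 1] with n hL hn
    rw [one_le_div hL]
    exact Real.log_le_log (by exact_mod_cast hn) (by exact_mod_cast Nat.le_succ n)
  · filter_upwards [eventually_log_natCast_pos, eventually_ge_atTop 1] with n hL hn
    have hpos : (0 : ℝ) < n := by exact_mod_cast hn
    have hle : ((n + 1 : ℕ) : ℝ) ≤ 2 * n := by exact_mod_cast (by omega : n + 1 ≤ 2 * n)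
    have h := Real.log_le_log (by positivity) hle
    rw [Real.log_mul (by norm_num) hpos.ne'] at h
    rw [div_le_iff₀ hL, add_mul, div_mul_cancel₀ _ hL.ne']
    linarith

section LogExponent

variable {p : ℝ} {a : ℕ → ℝ}

theorem tendsto_neg_log_succ_div_log
    (haSp : Tendsto (fun n : ℕ => (-Real.log (a n)) / Real.log n) atTop (𝓝 p)) :
    Tendsto (fun n : ℕ => (-Real.log (a (n + 1))) / Real.log n) atTop (𝓝 p) := by
  have h := (haSp.comp (tendsto_add_atTop_nat 1)).mul tendsto_log_div_log_succ
  rw [mul_one] at h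
  refine h.congr' ?_
  filter_upwards [(tendsto_add_atTop_nat 1).eventually eventually_log_natCast_pos] with n hL
  exact div_mul_div_cancel₀ hL.ne'

theorem eventually_lt_neg_log_gap_div_log (hapos : ∀ n, 0 < a n)
    (halim : Tendsto a atTop (𝓝 0))
    (haSp : Tendsto (fun n : ℕ => (-Real.log (a n)) / Real.log n) atTop (𝓝 p))
    (hagaps : ∀ n, a (n + 1) - a (n + 2) ≤ a n - a (n + 1)) {c : ℝ} (hc : c < p + 1) :
    ∀ᶠ n : ℕ in atTop, c < -Real.log (a n - a (n + 1)) / Real.log n := by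
  have hhalf : Tendsto (fun n : ℕ => n / 2) atTop atTop :=
    Nat.tendsto_div_const_atTop two_ne_zero
  have h := ((haSp.comp hhalf).add_const 1).mul tendsto_log_half_div_log
  rw [mul_one] at h
  filter_upwards [h.eventually (lt_mem_nhds hc), eventually_log_natCast_pos,
    hhalf.eventually eventually_log_natCast_pos, eventually_ge_atTop 2] with n hn hL hL' hn2
  refine hn.trans_le ?_
  have hg := gap_pos hapos halim hagaps n
  have hpos : (0 : ℝ) < (n / 2 : ℕ) := by exact_mod_cast (by omega : 0 < n / 2)
  have hmul : (n / 2 : ℕ) * (a n - a (n + 1)) ≤ a (n / 2) := by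
    have h₁ := nat_mul_gap_le_sub hagaps (n / 2) (n - n / 2)
    rw [Nat.add_sub_cancel' (Nat.div_le_self n 2)] at h₁
    have h₂ : ((n / 2 : ℕ) : ℝ) ≤ (n - n / 2 : ℕ) := by
      exact_mod_cast (by omega : n / 2 ≤ n - n / 2)
    have h₃ := mul_le_mul_of_nonneg_right h₂ hg.le
    linarith [hapos n]
  have hlog := Real.log_le_log (mul_pos hpos hg) hmul
  rw [Real.log_mul hpos.ne' hg.ne'] at hlog
  rw [← mul_div_assoc]
  refine div_le_div_of_nonneg_right ?_ hL.le
  simp only [Function.comp_apply]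
  rw [add_mul, div_mul_cancel₀ _ hL'.ne']
  linarith

theorem eventually_le_half_of_ceil_rpow (hp : 0 < p) (hapos : ∀ n, 0 < a n)
    (haSp : Tendsto (fun n : ℕ => (-Real.log (a n)) / Real.log n) atTop (𝓝 p))
    {δ : ℝ} (hδ : 0 < δ) :
    ∀ᶠ n : ℕ in atTop, a ⌈(n : ℝ) ^ (1 + δ)⌉₊ ≤ a n / 2 := by
  have hN : Tendsto (fun n : ℕ => ⌈(n : ℝ) ^ (1 + δ)⌉₊) atTop atTop :=
    tendsto_nat_ceil_atTop.comp
      ((tendsto_rpow_atTop (by linarith)).comp tendsto_natCast_atTop_atTop)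
  have h := (((haSp.comp hN).mul_const (1 + δ)).sub haSp).sub
    (tendsto_const_div_log_natCast (Real.log 2))
  have hlim : 0 < p * (1 + δ) - p - 0 := by nlinarith [mul_pos hp hδ]
  filter_upwards [h.eventually (lt_mem_nhds hlim), eventually_log_natCast_pos,
    hN.eventually eventually_log_natCast_pos, eventually_ge_atTop 1,
    (haSp.comp hN).eventually (lt_mem_nhds hp)] with n hn hL hLN hn1 hquot
  simp only [Function.comp_apply] at hn hquot
  have hpos : (0 : ℝ) < n := by exact_mod_cast hn1
  have hlogN : (1 + δ) * Real.log n ≤ Real.log (⌈(n : ℝ) ^ (1 + δ)⌉₊ : ℕ) := by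
    rw [← Real.log_rpow hpos]
    exact Real.log_le_log (by positivity) (Nat.le_ceil _)
  set N := ⌈(n : ℝ) ^ (1 + δ)⌉₊
  have hquot_mul := mul_le_mul_of_nonneg_left hlogN hquot.le
  rw [div_mul_cancel₀ _ hLN.ne'] at hquot_mul
  have hn' := mul_pos hn hL
  rw [sub_mul, sub_mul, div_mul_cancel₀ _ hL.ne', div_mul_cancel₀ _ hL.ne', mul_assoc] at hn'
  rw [← Real.log_le_log_iff (hapos N) (half_pos (hapos n)),
    Real.log_div (hapos n).ne' two_ne_zero]
  linarith

theorem eventually_neg_log_gap_div_log_lt (hp : 0 < p) (hapos : ∀ n, 0 < a n)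
    (hadec : Antitone a) (halim : Tendsto a atTop (𝓝 0))
    (haSp : Tendsto (fun n : ℕ => (-Real.log (a n)) / Real.log n) atTop (𝓝 p))
    (hagaps : ∀ n, a (n + 1) - a (n + 2) ≤ a n - a (n + 1)) {c : ℝ} (hc : p + 1 < c) :
    ∀ᶠ n : ℕ in atTop, -Real.log (a n - a (n + 1)) / Real.log n < c := by
  obtain ⟨δ, hδ, hδc⟩ : ∃ δ : ℝ, 0 < δ ∧ p + (1 + δ) + 0 < c :=
    ⟨(c - (p + 1)) / 2, by linarith, by linarith⟩
  have h := (haSp.add_const (1 + δ)).add (tendsto_const_div_log_natCast (Real.log 4))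
  filter_upwards [h.eventually (gt_mem_nhds hδc), eventually_log_natCast_pos,
    eventually_le_half_of_ceil_rpow hp hapos haSp hδ, eventually_ge_atTop 1]
    with n hn hL hhalf hn1
  refine lt_of_le_of_lt ?_ hn
  have hg := gap_pos hapos halim hagaps n
  have hone : (1 : ℝ) ≤ n := by exact_mod_cast hn1
  have hpow : 1 ≤ (n : ℝ) ^ (1 + δ) := Real.one_le_rpow hone (by linarith)
  have hceil : (⌈(n : ℝ) ^ (1 + δ)⌉₊ : ℝ) ≤ 2 * (n : ℝ) ^ (1 + δ) := by
    linarith [Nat.ceil_lt_add_one (zero_le_one.trans hpow)]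
  set N := ⌈(n : ℝ) ^ (1 + δ)⌉₊
  have hmul : a n ≤ 4 * (n : ℝ) ^ (1 + δ) * (a n - a (n + 1)) := by
    have h₁ := sub_le_nat_mul_gap hagaps n N
    have h₂ : a (n + N) ≤ a N := hadec (Nat.le_add_left N n)
    have h₃ := mul_le_mul_of_nonneg_right hceil hg.le
    linarith
  have hlog := Real.log_le_log (hapos n) hmul
  rw [Real.log_mul (by positivity) hg.ne', Real.log_mul (by norm_num) (by positivity),
    Real.log_rpow (by linarith)] at hlog
  rw [div_le_iff₀ hL, add_mul, add_mul, div_mul_cancel₀ _ hL.ne', div_mul_cancel₀ _ hL.ne']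
  linarith

theorem tendsto_neg_log_gap_div_log (hp : 0 < p) (hapos : ∀ n, 0 < a n)
    (hadec : Antitone a) (halim : Tendsto a atTop (𝓝 0))
    (haSp : Tendsto (fun n : ℕ => (-Real.log (a n)) / Real.log n) atTop (𝓝 p))
    (hagaps : ∀ n, a (n + 1) - a (n + 2) ≤ a n - a (n + 1)) :
    Tendsto (fun n : ℕ => -Real.log (a n - a (n + 1)) / Real.log n) atTop (𝓝 (p + 1)) :=
  tendsto_order.2 ⟨fun _ hc => eventually_lt_neg_log_gap_div_log hapos halim haSp hagaps hc,
    fun _ hc => eventually_neg_log_gap_div_log_lt hp hapos hadec halim haSp hagaps hc⟩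

end LogExponent

/-- **Gap estimate (proof of Lemma 1.9, equation (2.12)).** Let `p > 0` and let
`a ∈ S_p` be a decreasing sequence with decreasing gaps. Then for every `ε > 0`
there is `n₀` such that for all `n ≥ n₀` and all `x ∈ [a (n+1), a n]`,
`x^(1 + 1/p + ε) ≤ a n − a (n+1) ≤ x^(1 + 1/p − ε)`. -/
theorem gap_estimate
    (p : ℝ) (hp : 0 < p) (a : ℕ → ℝ) (hapos : ∀ n, 0 < a n)
    (hadec : Antitone a) (halim : Tendsto a atTop (𝓝 0))
    (haSp : Tendsto (fun n : ℕ => (-Real.log (a n)) / Real.log n) atTop (𝓝 p))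
    (hagaps : ∀ n, a (n + 1) - a (n + 2) ≤ a n - a (n + 1)) :
    ∀ ε > (0 : ℝ), ∃ n₀ : ℕ, ∀ n ≥ n₀, ∀ x ∈ Set.Icc (a (n + 1)) (a n),
      x ^ (1 + 1 / p + ε) ≤ a n - a (n + 1) ∧
        a n - a (n + 1) ≤ x ^ (1 + 1 / p - ε) := by
  intro ε hε
  have hg := gap_pos hapos halim hagaps
  have hglim := tendsto_neg_log_gap_div_log hp hapos hadec halim haSp hagaps
  have hlower := (haSp.mul_const (1 + 1 / p + ε)).sub hglim
  have hupper := hglim.sub ((tendsto_neg_log_succ_div_log haSp).mul_const (1 + 1 / p - ε))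
  have hlower_pos : 0 < p * (1 + 1 / p + ε) - (p + 1) := by
    have : p * (1 + 1 / p + ε) - (p + 1) = p * ε := by field_simp; ring
    rw [this]; positivity
  have hupper_pos : 0 < p + 1 - p * (1 + 1 / p - ε) := by
    have : p + 1 - p * (1 + 1 / p - ε) = p * ε := by field_simp; ring
    rw [this]; positivity
  rw [← eventually_atTop]
  filter_upwards [hlower.eventually (lt_mem_nhds hlower_pos),
    hupper.eventually (lt_mem_nhds hupper_pos), eventually_log_natCast_pos,
    halim.eventually (gt_mem_nhds one_pos)] with n hlow hup hL hone x hx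
  have hx0 : 0 < x := (hapos _).trans_le hx.1
  have hlow' := mul_pos hlow hL
  have hup' := mul_pos hup hL
  rw [sub_mul, mul_right_comm, div_mul_cancel₀ _ hL.ne', div_mul_cancel₀ _ hL.ne'] at hlow' hup'
  constructor
  · calc x ^ (1 + 1 / p + ε) ≤ a n ^ (1 + 1 / p + ε) :=
          Real.rpow_le_rpow hx0.le hx.2 (by positivity)
      _ ≤ a n - a (n + 1) := by
          rw [← Real.log_le_log_iff (Real.rpow_pos_of_pos (hapos n) _) (hg n),
            Real.log_rpow (hapos n)]
          linarith
  · rcases le_total 0 (1 + 1 / p - ε) with hexp | hexp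
    · calc a n - a (n + 1) ≤ a (n + 1) ^ (1 + 1 / p - ε) := by
            rw [← Real.log_le_log_iff (hg n) (Real.rpow_pos_of_pos (hapos _) _),
              Real.log_rpow (hapos _)]
            linarith
        _ ≤ x ^ (1 + 1 / p - ε) := Real.rpow_le_rpow (hapos _).le hx.1 hexp
    · have := Real.one_le_rpow_of_pos_of_le_one_of_nonpos hx0 (hx.2.trans hone.le) hexp
      linarith [hapos (n + 1)]
end

section
/- Let a = (a_n)_n and b = (b_m)_m be strictly decreasing sequences of positive reals converging to 0 such that for every n ∈ ℕ there exists m with a_{n+1} ≤ b_m ≤ a_n. For r > 0 and a bounded set E ⊆ ℝ let P_r(E) denote the maximal cardinality of an r-separated subset of E. Then for every r > 0, P_r({b_m : m ∈ ℕ}) ≥ ½ (P_r({a_n : n ∈ ℕ}) − 2). -/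
open Filter Topology

/-- `sepNumber r E` is the maximal cardinality of an `r`-separated subset of `E`
(any two distinct points at distance at least `r`). -/
noncomputable def sepNumber (r : ℝ) (E : Set ℝ) : ℕ :=
  sSup {n : ℕ | ∃ S : Finset ℝ, ↑S ⊆ E ∧ S.card = n ∧
    ∀ x ∈ S, ∀ y ∈ S, x ≠ y → r ≤ |x - y|}

/-- The set of cardinalities of `r`-separated subsets of a bounded set is bounded above. -/
lemma bddAbove_card_separated {r : ℝ} (hr : 0 < r) {E : Set ℝ} {c d : ℝ} (hE : E ⊆ Set.Icc c d) :
    BddAbove {n : ℕ | ∃ S : Finset ℝ, ↑S ⊆ E ∧ S.card = n ∧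
      ∀ x ∈ S, ∀ y ∈ S, x ≠ y → r ≤ |x - y|} := by
  refine ⟨(Finset.Icc ⌊c / r⌋ ⌊d / r⌋).card, ?_⟩
  rintro n ⟨S, hSE, rfl, hS⟩
  refine Finset.card_le_card_of_injOn (fun x => ⌊x / r⌋) ?_ ?_
  · intro x hx
    have hx' := hE (hSE hx)
    simp only [Finset.coe_Icc, Set.mem_Icc]
    exact ⟨Int.floor_le_floor (by gcongr; exact hx'.1),
      Int.floor_le_floor (by gcongr; exact hx'.2)⟩
  · intro x hx y hy hxy
    by_contra hne
    have hlt : |x / r - y / r| < 1 := Int.abs_sub_lt_one_of_floor_eq_floor hxy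
    rw [← sub_div, abs_div, abs_of_pos hr, div_lt_one hr] at hlt
    exact absurd (hS x hx y hy hne) (not_le.mpr hlt)

/-- If `b` meets every gap `[a (n + 1), a n]` of the antitone sequence `a`, then every
`r`-separated subset of `Set.range a` yields an `r`-separated subset of `Set.range b` of
at least half the size, rounded down. -/
lemma exists_separated_card_half {a b : ℕ → ℝ} (ha : StrictAnti a)
    (hsep : ∀ n : ℕ, ∃ m : ℕ, a (n + 1) ≤ b m ∧ b m ≤ a n) {r : ℝ} (hr : 0 < r)
    {S : Finset ℝ} (hSa : ↑S ⊆ Set.range a)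
    (hS : ∀ x ∈ S, ∀ y ∈ S, x ≠ y → r ≤ |x - y|) :
    ∃ T : Finset ℝ, ↑T ⊆ Set.range b ∧ T.card = S.card / 2 ∧
      ∀ x ∈ T, ∀ y ∈ T, x ≠ y → r ≤ |x - y| := by
  let x := S.orderEmbOfFin rfl
  have hxS : ∀ i, x i ∈ S := fun i => S.orderEmbOfFin_mem rfl i
  choose idx hidx using fun i => hSa (hxS i)
  choose f hf_ge hf_le using hsep
  let g : Fin (S.card / 2) → Fin S.card := fun j => ⟨2 * j, by omega⟩
  let y : Fin (S.card / 2) → ℝ := fun j => b (f (idx (g j)))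
  have hgap : ∀ i j, i < j → r ≤ y j - y i := by
    intro i j hij
    have hij' : (i : ℕ) < j := hij
    let p : Fin S.card := ⟨2 * i + 1, by omega⟩
    have hgp : x (g i) < x p := x.strictMono (by simp [Fin.lt_def, g, p])
    have hpg : x p < x (g j) := x.strictMono (by simp only [Fin.lt_def, g, p]; omega)
    have hr' := hS _ (hxS p) _ (hxS (g i)) hgp.ne'
    rw [abs_of_pos (sub_pos.mpr hgp)] at hr'
    have hlow : x p ≤ y j := by
      rw [← hidx, ← hidx, ha.lt_iff_gt] at hpg
      rw [← hidx]
      exact (ha.antitone (Nat.succ_le_of_lt hpg)).trans (hf_ge _)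
    have hup : y i ≤ x (g i) := by
      rw [← hidx]
      exact hf_le _
    linarith
  have hmono : StrictMono y := fun i j hij => by linarith [hgap i j hij]
  refine ⟨Finset.univ.image y, ?_, ?_, ?_⟩
  · intro z hz
    obtain ⟨j, -, rfl⟩ := Finset.mem_image.mp (Finset.mem_coe.mp hz)
    exact ⟨_, rfl⟩
  · rw [Finset.card_image_of_injective _ hmono.injective, Finset.card_fin]
  · simp only [Finset.mem_image, Finset.mem_univ, true_and]
    rintro _ ⟨i, rfl⟩ _ ⟨j, rfl⟩ hne
    rcases lt_trichotomy i j with hij | rfl | hij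
    · rw [abs_sub_comm]
      exact (hgap i j hij).trans (le_abs_self _)
    · exact absurd rfl hne
    · exact (hgap j i hij).trans (le_abs_self _)

/-- **Separated-set comparison (proof of Lemma 1.8).** Let `a`, `b` be strictly
decreasing sequences of positive reals converging to `0` such that for every `n`
some `b m` lies in `[a (n+1), a n]`. Then for every `r > 0`,
`P_r({b_m}) ≥ ½ (P_r({a_n}) − 2)`. -/
theorem sepNumber_comparison
    (a b : ℕ → ℝ) (hapos : ∀ n, 0 < a n) (hbpos : ∀ n, 0 < b n)
    (haanti : StrictAnti a) (hbanti : StrictAnti b)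
    (halim : Tendsto a atTop (𝓝 0)) (hblim : Tendsto b atTop (𝓝 0))
    (hsep : ∀ n : ℕ, ∃ m : ℕ, a (n + 1) ≤ b m ∧ b m ≤ a n) :
    ∀ r > (0 : ℝ),
      ((sepNumber r (Set.range a) : ℝ) - 2) / 2 ≤ (sepNumber r (Set.range b) : ℝ) := by
  intro r hr
  have hbdd := bddAbove_card_separated hr (E := Set.range b) (c := 0) (d := b 0) (by
    rintro _ ⟨n, rfl⟩
    exact ⟨(hbpos n).le, hbanti.antitone (Nat.zero_le n)⟩)
  have hle : sepNumber r (Set.range a) ≤ 2 * sepNumber r (Set.range b) + 2 := by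
    refine csSup_le ⟨0, ∅, by simp⟩ ?_
    rintro n ⟨S, hSa, rfl, hS⟩
    have hhalf : S.card / 2 ≤ sepNumber r (Set.range b) :=
      le_csSup hbdd (exists_separated_card_half haanti hsep hr hSa hS)
    omega
  have hle' : (sepNumber r (Set.range a) : ℝ) ≤ 2 * sepNumber r (Set.range b) + 2 := by
    exact_mod_cast hle
  linarith
end
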